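/- arXiv:math/9907106 — 3 statements merged into one kernel-verified Lean document; each statement's English description precedes it below -/
import Mathlib

section
/- Let (A,R) be a finite-dimensional triangular pointed Hopf algebra over a field k of characteristic 0 such that the minimal sub-Hopf-algebra A_R corresponding to R is not semisimple. Then dim(A) is divisible by 4. -/
open TensorProduct

noncomputable section

universe u v w

namespace Paper

variable (k : Type*) [Field k]

section Basic

variable (A : Type*) [Ring A] [HopfAlgebra k A]

/-- `g` is a grouplike element of the Hopf algebra `A`. -/
def IsGrouplike (g : A) : Prop :=
  Coalgebra.counit (R := k) g = 1 ∧ Coalgebra.comul (R := k) g = g ⊗ₜ[k] g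

/-- `x` is a `g:h` skew primitive element of `A`, i.e. `Δ(x) = x ⊗ g + h ⊗ x`. -/
def IsSkewPrimitive (g h x : A) : Prop :=
  Coalgebra.comul (R := k) x = x ⊗ₜ[k] g + h ⊗ₜ[k] x

/-- The space `P_{g,h}(A)` of `g:h` skew primitives, as a submodule. -/
def skewPrimitives (g h : A) : Submodule k A :=
  LinearMap.ker (Coalgebra.comul (R := k) -
    ((TensorProduct.mk k A A).flip g + TensorProduct.mk k A A h))

end Basic

section Coalg

variable {M : Type*} [AddCommGroup M] [Module k M]

/-- `C` is a subcoalgebra with respect to the comultiplication `d`. -/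
def IsSubcoalgebraOf (d : M →ₗ[k] M ⊗[k] M) (C : Submodule k M) : Prop :=
  ∀ x ∈ C, d x ∈ LinearMap.range (TensorProduct.map C.subtype C.subtype)

/-- `C` is a simple subcoalgebra with respect to `d`. -/
def IsSimpleSubcoalgebraOf (d : M →ₗ[k] M ⊗[k] M) (C : Submodule k M) : Prop :=
  C ≠ ⊥ ∧ IsSubcoalgebraOf k d C ∧
    ∀ D : Submodule k M, IsSubcoalgebraOf k d D → D ≤ C → D = ⊥ ∨ D = C

/-- A coalgebra is pointed if all its simple subcoalgebras are `1`-dimensional. -/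
def IsPointedOf (d : M →ₗ[k] M ⊗[k] M) : Prop :=
  ∀ C : Submodule k M, IsSimpleSubcoalgebraOf k d C → Module.finrank k C = 1

/-- The coradical: the sum of all simple subcoalgebras. -/
def coradicalOf (d : M →ₗ[k] M ⊗[k] M) : Submodule k M :=
  sSup {C | IsSimpleSubcoalgebraOf k d C}

/-- The first term `A₁ = Δ⁻¹(A₀ ⊗ A + A ⊗ A₀)` of the coradical filtration. -/
def firstCoradicalTermOf (d : M →ₗ[k] M ⊗[k] M) : Submodule k M :=
  Submodule.comap d
    (LinearMap.range (TensorProduct.map (coradicalOf k d).subtype (LinearMap.id (M := M))) ⊔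
      LinearMap.range (TensorProduct.map (LinearMap.id (M := M)) (coradicalOf k d).subtype))

end Coalg

section Hopf

variable (A : Type*) [Ring A] [HopfAlgebra k A]

/-- A Hopf algebra is pointed if all its simple subcoalgebras are `1`-dimensional. -/
def IsPointed : Prop := IsPointedOf k (Coalgebra.comul (R := k) (A := A))

/-- A subalgebra `B` of `A` is a sub-Hopf-algebra if it is closed under
comultiplication and under the antipode. -/
def IsSubHopf (B : Subalgebra k A) : Prop :=
  (∀ x ∈ B, Coalgebra.comul (R := k) x ∈
      LinearMap.range (TensorProduct.map B.toSubmodule.subtype B.toSubmodule.subtype)) ∧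
  ∀ x ∈ B, HopfAlgebra.antipode (R := k) x ∈ B

/-- `r` belongs to `K ⊗ K ⊆ A ⊗ A` for a submodule `K` of `A`. -/
def MemTensorSquare (K : Submodule k A) (r : A ⊗[k] A) : Prop :=
  r ∈ LinearMap.range (TensorProduct.map K.subtype K.subtype)

/-- `(Δ ⊗ id)(r) = r₁₃ r₂₃`. -/
def Hexagon₁ (r : A ⊗[k] A) : Prop :=
  Algebra.TensorProduct.map (Bialgebra.comulAlgHom k A) (AlgHom.id k A) r =
    Algebra.TensorProduct.map (Algebra.TensorProduct.includeLeft (R := k) (S := k)) (AlgHom.id k A) r *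
      Algebra.TensorProduct.map (Algebra.TensorProduct.includeRight (R := k)) (AlgHom.id k A) r

/-- `(id ⊗ Δ)(r) = r₁₃ r₁₂`. -/
def Hexagon₂ (r : A ⊗[k] A) : Prop :=
  Algebra.TensorProduct.map (AlgHom.id k A) (Bialgebra.comulAlgHom k A) r =
    Algebra.TensorProduct.map (AlgHom.id k A) (Algebra.TensorProduct.includeRight (R := k)) r *
      Algebra.TensorProduct.map (AlgHom.id k A) (Algebra.TensorProduct.includeLeft (R := k) (S := k)) r

/-- The Drinfeld element `u = Σ S(R⁽²⁾) R⁽¹⁾` associated to an element `r ∈ A ⊗ A`. -/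
def drinfeldOf (r : A ⊗[k] A) : A :=
  LinearMap.mul' k A
    ((TensorProduct.map (HopfAlgebra.antipode (R := k)) LinearMap.id)
      ((TensorProduct.comm k A A) r))

/-- A quasitriangular structure on the Hopf algebra `A`. -/
structure QuasiTriangular where
  /-- the R-matrix -/
  R : A ⊗[k] A
  isUnit : IsUnit R
  intertwine : ∀ a : A,
    (TensorProduct.comm k A A) (Coalgebra.comul (R := k) a) * R = R * Coalgebra.comul (R := k) a
  hexagon₁ : Hexagon₁ k A R
  hexagon₂ : Hexagon₂ k A R

variable {A}

/-- A quasitriangular Hopf algebra is triangular if `R R₂₁ = 1 ⊗ 1`. -/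
def QuasiTriangular.IsTriangular (Q : QuasiTriangular k A) : Prop :=
  Q.R * (TensorProduct.comm k A A) Q.R = 1

/-- `(A,R)` is minimal if no proper sub-Hopf-algebra contains the components of `R`. -/
def QuasiTriangular.IsMinimal (Q : QuasiTriangular k A) : Prop :=
  ∀ B : Subalgebra k A, IsSubHopf k A B → MemTensorSquare k A B.toSubmodule Q.R → B = ⊤

/-- The Drinfeld element of a quasitriangular Hopf algebra. -/
def QuasiTriangular.drinfeld (Q : QuasiTriangular k A) : A := drinfeldOf k A Q.R

/-- The map `f_R : A* → A`, `p ↦ (p ⊗ I)(R)`. -/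
def fR (Q : QuasiTriangular k A) : Module.Dual k A →ₗ[k] A :=
  TensorProduct.lift
    (LinearMap.mk₂ k (fun a b => (Module.Dual.eval k A a).smulRight b)
      (fun a a' b => by ext p; simp [add_smul])
      (fun c a b => by ext p; simp [smul_smul])
      (fun a b b' => by ext p; simp [smul_add])
      (fun c a b => by ext p; simp [smul_comm (p a) c b])) Q.R

/-- Radford's coinvariants `B = {x ∈ A | (I ⊗ π)Δ(x) = x ⊗ 1}` of a projection `π`. -/
def coinvariants (π : A →ₗ[k] A) : Submodule k A :=
  LinearMap.ker
    ((TensorProduct.map LinearMap.id π) ∘ₗ Coalgebra.comul (R := k) -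
      (TensorProduct.mk k A A).flip 1)

end Hopf


section Drinfeld

open HopfAlgebra

variable {k} {A : Type*} [Ring A] [HopfAlgebra k A] (Q : QuasiTriangular k A)
  {X : Type*} [AddCommGroup X] [Module k X] {s : Finset (A × A)}

/-- Evaluation of a linear map on the first hexagon identity, in terms of a presentation of `R`. -/
lemma QuasiTriangular.sum_hexagon₁ (hs : Q.R = ∑ i ∈ s, i.1 ⊗ₜ[k] i.2)
    (F : (A ⊗[k] A) ⊗[k] A →ₗ[k] X) :
    ∑ i ∈ s, F (Coalgebra.comul (R := k) i.1 ⊗ₜ i.2) =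
      ∑ i ∈ s, ∑ j ∈ s, F ((i.1 ⊗ₜ j.1) ⊗ₜ (i.2 * j.2)) := by
  have h := Q.hexagon₁
  simp only [Hexagon₁, hs, map_sum, Finset.sum_mul_sum, Algebra.TensorProduct.map_tmul,
    Bialgebra.comulAlgHom_apply, AlgHom.coe_id, id_eq,
    Algebra.TensorProduct.includeLeft_apply, Algebra.TensorProduct.includeRight_apply,
    Algebra.TensorProduct.tmul_mul_tmul, mul_one, one_mul] at h
  simpa only [map_sum] using congrArg F h

/-- Evaluation of a linear map on the second hexagon identity, in terms of a presentation of `R`. -/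
lemma QuasiTriangular.sum_hexagon₂ (hs : Q.R = ∑ i ∈ s, i.1 ⊗ₜ[k] i.2)
    (F : A ⊗[k] (A ⊗[k] A) →ₗ[k] X) :
    ∑ i ∈ s, F (i.1 ⊗ₜ Coalgebra.comul (R := k) i.2) =
      ∑ i ∈ s, ∑ j ∈ s, F ((i.1 * j.1) ⊗ₜ (j.2 ⊗ₜ i.2)) := by
  have h := Q.hexagon₂
  simp only [Hexagon₂, hs, map_sum, Finset.sum_mul_sum, Algebra.TensorProduct.map_tmul,
    Bialgebra.comulAlgHom_apply, AlgHom.coe_id, id_eq,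
    Algebra.TensorProduct.includeLeft_apply, Algebra.TensorProduct.includeRight_apply,
    Algebra.TensorProduct.tmul_mul_tmul, mul_one, one_mul] at h
  simpa only [map_sum] using congrArg F h

lemma mul_antipode_left_apply (a : A) :
    LinearMap.mul' k A (TensorProduct.map (antipode k) LinearMap.id (Coalgebra.comul (R := k) a)) =
      Coalgebra.counit (R := k) a • 1 := by
  rw [← Algebra.algebraMap_eq_smul_one]
  exact mul_antipode_rTensor_comul_apply a

lemma mul_antipode_right_apply (a : A) :
    LinearMap.mul' k A (TensorProduct.map LinearMap.id (antipode k) (Coalgebra.comul (R := k) a)) =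
      Coalgebra.counit (R := k) a • 1 := by
  rw [← Algebra.algebraMap_eq_smul_one]
  exact mul_antipode_lTensor_comul_apply a

lemma counit_left_apply (a : A) :
    TensorProduct.lid k A (TensorProduct.map (Coalgebra.counit (R := k)) LinearMap.id
      (Coalgebra.comul (R := k) a)) = a := by
  exact (congrArg (TensorProduct.lid k A) (Coalgebra.rTensor_counit_comul (R := k) a)).trans
    (by simp)

lemma counit_right_apply (a : A) :
    TensorProduct.rid k A (TensorProduct.map LinearMap.id (Coalgebra.counit (R := k))
      (Coalgebra.comul (R := k) a)) = a := by
  exact (congrArg (TensorProduct.rid k A) (Coalgebra.lTensor_counit_comul (R := k) a)).trans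
    (by simp)

lemma QuasiTriangular.sum_counit_smul_right (hs : Q.R = ∑ i ∈ s, i.1 ⊗ₜ[k] i.2) :
    ∑ i ∈ s, Coalgebra.counit (R := k) i.1 • i.2 = 1 := by
  have h := Q.sum_hexagon₁ hs (TensorProduct.map ((TensorProduct.lid k A).toLinearMap ∘ₗ
    TensorProduct.map (Coalgebra.counit (R := k)) LinearMap.id) LinearMap.id)
  simp only [TensorProduct.map_tmul, LinearMap.comp_apply, counit_left_apply,
    LinearEquiv.coe_coe, LinearMap.id_apply, TensorProduct.lid_tmul] at h
  rw [← hs] at h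
  have h1 : Q.R = (1 ⊗ₜ (∑ i ∈ s, Coalgebra.counit (R := k) i.1 • i.2)) * Q.R := by
    conv_rhs => rw [hs]
    rw [TensorProduct.tmul_sum, Finset.sum_mul_sum]
    simpa [TensorProduct.smul_tmul] using h
  have h2 : (1 : A ⊗[k] A) = 1 ⊗ₜ (∑ i ∈ s, Coalgebra.counit (R := k) i.1 • i.2) :=
    Q.isUnit.mul_right_cancel (by rw [one_mul]; exact h1)
  simpa [Algebra.TensorProduct.one_def] using (congrArg (fun t => TensorProduct.lid k A
    (TensorProduct.map (Coalgebra.counit (R := k)) LinearMap.id t)) h2).symm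

lemma QuasiTriangular.sum_counit_smul_left (hs : Q.R = ∑ i ∈ s, i.1 ⊗ₜ[k] i.2) :
    ∑ i ∈ s, Coalgebra.counit (R := k) i.2 • i.1 = 1 := by
  have h := Q.sum_hexagon₂ hs (TensorProduct.map LinearMap.id ((TensorProduct.lid k A).toLinearMap ∘ₗ
    TensorProduct.map (Coalgebra.counit (R := k)) LinearMap.id))
  simp only [TensorProduct.map_tmul, LinearMap.comp_apply, counit_left_apply,
    LinearEquiv.coe_coe, LinearMap.id_apply, TensorProduct.lid_tmul] at h
  rw [← hs] at h
  have h1 : Q.R = Q.R * ((∑ i ∈ s, Coalgebra.counit (R := k) i.2 • i.1) ⊗ₜ 1) := by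
    conv_rhs => rw [hs]
    rw [TensorProduct.sum_tmul, Finset.sum_mul_sum]
    simpa [TensorProduct.smul_tmul] using h
  have h2 : (1 : A ⊗[k] A) = (∑ i ∈ s, Coalgebra.counit (R := k) i.2 • i.1) ⊗ₜ 1 :=
    Q.isUnit.mul_left_cancel (by rw [mul_one]; exact h1)
  simpa [Algebra.TensorProduct.one_def] using (congrArg (fun t => TensorProduct.rid k A
    (TensorProduct.map LinearMap.id (Coalgebra.counit (R := k)) t)) h2).symm

/-- `(S ⊗ id)(R) R = 1`. -/
lemma QuasiTriangular.antipode_left_mul_R :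
    TensorProduct.map (antipode k) LinearMap.id Q.R * Q.R = 1 := by
  obtain ⟨s, hs⟩ := TensorProduct.exists_finset Q.R
  have h := Q.sum_hexagon₁ hs (TensorProduct.map (LinearMap.mul' k A ∘ₗ
    TensorProduct.map (antipode k) LinearMap.id) LinearMap.id)
  simp only [TensorProduct.map_tmul, LinearMap.comp_apply, mul_antipode_left_apply,
    LinearMap.id_apply, LinearMap.mul'_apply, TensorProduct.smul_tmul,
    ← TensorProduct.tmul_sum, Q.sum_counit_smul_right hs] at h
  simp only [hs, map_sum, Finset.sum_mul_sum, TensorProduct.map_tmul,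
    Algebra.TensorProduct.tmul_mul_tmul, LinearMap.id_apply]
  exact h.symm

/-- `(id ⊗ S)(R)` is inverse to `R` in `A ⊗ Aᵒᵖ`. -/
lemma QuasiTriangular.sum_mul_tmul_antipode_mul (hs : Q.R = ∑ i ∈ s, i.1 ⊗ₜ[k] i.2) :
    ∑ i ∈ s, ∑ j ∈ s, (i.1 * j.1) ⊗ₜ[k] (antipode k j.2 * i.2) = 1 := by
  have h := Q.sum_hexagon₂ hs (TensorProduct.map LinearMap.id (LinearMap.mul' k A ∘ₗ
    TensorProduct.map (antipode k) LinearMap.id))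
  simp only [TensorProduct.map_tmul, LinearMap.comp_apply, mul_antipode_left_apply,
    LinearMap.id_apply, LinearMap.mul'_apply, ← TensorProduct.smul_tmul,
    ← TensorProduct.sum_tmul, Q.sum_counit_smul_left hs] at h
  exact h.symm

variable {Q}

/-- For triangular `R`, `(S ⊗ id)(R) = R₂₁`. -/
lemma QuasiTriangular.IsTriangular.antipode_left (hQ : Q.IsTriangular) :
    TensorProduct.map (antipode k) LinearMap.id Q.R = TensorProduct.comm k A A Q.R :=
  left_inv_eq_right_inv Q.antipode_left_mul_R hQ

/-- For triangular `R`, `R = ∑ R⁽²⁾ ⊗ S(R⁽¹⁾)`. -/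
lemma QuasiTriangular.IsTriangular.sum_swap (hQ : Q.IsTriangular)
    (hs : Q.R = ∑ i ∈ s, i.1 ⊗ₜ[k] i.2) :
    ∑ i ∈ s, i.1 ⊗ₜ[k] i.2 = ∑ i ∈ s, i.2 ⊗ₜ[k] antipode k i.1 := by
  have h := congrArg (TensorProduct.comm k A A) hQ.antipode_left
  simpa [hs, map_sum] using h.symm

variable (Q)

lemma QuasiTriangular.drinfeld_eq_sum (hs : Q.R = ∑ i ∈ s, i.1 ⊗ₜ[k] i.2) :
    Q.drinfeld = ∑ i ∈ s, antipode k i.2 * i.1 := by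
  simp [QuasiTriangular.drinfeld, drinfeldOf, hs, map_sum]

end Drinfeld

section DrinfeldProperties

open HopfAlgebra

variable {k} {A : Type*} [Ring A] [HopfAlgebra k A] (Q : QuasiTriangular k A) {s : Finset (A × A)}

/-- The antipode reverses the comultiplication. -/
lemma comul_antipode (a : A) :
    Coalgebra.comul (R := k) (antipode k a) =
      TensorProduct.map (antipode k) (antipode k)
        (TensorProduct.comm k A A (Coalgebra.comul (R := k) a)) := by
  have h : WithConv.toConv (Coalgebra.comul (R := k) ∘ₗ antipode k (A := A)) *
      WithConv.toConv (Coalgebra.comul (R := k)) = 1 := by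
    have h1 := LinearMap.algHom_comp_convMul_distrib (Bialgebra.comulAlgHom k A)
      (WithConv.toConv (antipode k)) (WithConv.toConv LinearMap.id)
    rw [LinearMap.antipode_mul_id] at h1
    refine WithConv.ext (h1.symm.trans ?_)
    ext a
    simp [LinearMap.convOne_def]
  have h' : WithConv.toConv (Coalgebra.comul (R := k) (A := A)) * WithConv.toConv
      (TensorProduct.map (antipode k) (antipode k) ∘ₗ (TensorProduct.comm k A A).toLinearMap ∘ₗ
        Coalgebra.comul (R := k)) = 1 := by
    let J : (A ⊗[k] A) ⊗[k] (A ⊗[k] A) →ₗ[k] A ⊗[k] A := LinearMap.mul' k (A ⊗[k] A) ∘ₗ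
      TensorProduct.map LinearMap.id
        (TensorProduct.map (antipode k) (antipode k) ∘ₗ (TensorProduct.comm k A A).toLinearMap)
    let M : A ⊗[k] (A ⊗[k] (A ⊗[k] A)) →ₗ[k] A ⊗[k] A :=
      J ∘ₗ (TensorProduct.assoc k A A (A ⊗[k] A)).symm.toLinearMap
    have hM (x : A) (t : A ⊗[k] A) (w : A) : M (x ⊗ₜ TensorProduct.assoc k A A A (t ⊗ₜ w)) =
        (x * antipode k w) ⊗ₜ LinearMap.mul' k A (TensorProduct.map LinearMap.id (antipode k) t) := by
      induction t with
      | zero => simp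
      | add y z hy hz => simp only [TensorProduct.add_tmul, TensorProduct.tmul_add, map_add, hy, hz]
      | tmul y z => simp [M, J]
    have hM' (x b : A) : M (x ⊗ₜ (Coalgebra.comul (R := k)).lTensor A (Coalgebra.comul b)) =
        (x * antipode k b) ⊗ₜ 1 := by
      have hb := counit_left_apply (k := k) b
      rw [← Coalgebra.coassoc_apply]
      generalize Coalgebra.comul (R := k) b = t at hb ⊢
      subst hb
      induction t with
      | zero => simp
      | add y z hy hz => simp only [map_add, TensorProduct.tmul_add, TensorProduct.add_tmul,
          mul_add, hy, hz]
      | tmul y z => simp [hM, mul_antipode_right_apply, TensorProduct.smul_tmul]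
    ext a
    have ha := mul_antipode_right_apply (k := k) a
    have hassoc := Coalgebra.coassoc_apply (R := k) a
    have h2 : ∀ t : (A ⊗[k] A) ⊗[k] A, J (TensorProduct.map LinearMap.id (Coalgebra.comul) t) =
        M ((TensorProduct.map LinearMap.id (Coalgebra.comul.lTensor A))
          (TensorProduct.assoc k A A A t)) := by
      intro t
      induction t with
      | zero => simp
      | add y z hy hz => simp only [map_add, hy, hz]
      | tmul t z =>
        induction t with
        | zero => simp
        | add x y hx hy => simp only [TensorProduct.add_tmul, map_add, hx, hy]
        | tmul x y => simp [M]
    have h3 : ∀ t : A ⊗[k] A, M ((TensorProduct.map LinearMap.id (Coalgebra.comul.lTensor A))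
        (Coalgebra.comul.lTensor A t)) =
          (LinearMap.mul' k A (TensorProduct.map LinearMap.id (antipode k) t)) ⊗ₜ 1 := by
      intro t
      induction t with
      | zero => simp
      | add y z hy hz => simp only [map_add, TensorProduct.add_tmul, hy, hz]
      | tmul y z => simp [hM']
    have h4 := h2 (Coalgebra.comul.rTensor A (Coalgebra.comul a))
    rw [hassoc, h3, ha] at h4
    rw [LinearMap.convOne_apply, Algebra.algebraMap_eq_smul_one, Algebra.TensorProduct.one_def,
      TensorProduct.smul_tmul', ← h4]
    change LinearMap.mul' k (A ⊗[k] A) (TensorProduct.map Coalgebra.comul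
      (TensorProduct.map (antipode k) (antipode k) ∘ₗ (TensorProduct.comm k A A).toLinearMap ∘ₗ
        Coalgebra.comul (R := k)) (Coalgebra.comul (R := k) a)) = _
    generalize Coalgebra.comul (R := k) a = t
    induction t with
    | zero => simp
    | add x y hx hy => simp only [map_add, hx, hy]
    | tmul x y => simp [J]
  exact LinearMap.congr_fun (congrArg WithConv.ofConv (left_inv_eq_right_inv h h')) a

/-- Conjugation by the Drinfeld element is the square of the antipode. -/
lemma QuasiTriangular.drinfeld_mul (a : A) :
    antipode k (antipode k a) * Q.drinfeld = Q.drinfeld * a := by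
  obtain ⟨s, hs⟩ := TensorProduct.exists_finset Q.R
  have hu := Q.drinfeld_eq_sum hs
  set u := Q.drinfeld
  let Ψ : (A ⊗[k] A) ⊗[k] A →ₗ[k] A := LinearMap.mul' k A ∘ₗ
    (TensorProduct.comm k A A).toLinearMap ∘ₗ TensorProduct.map
      (LinearMap.mul' k A ∘ₗ (TensorProduct.comm k A A).toLinearMap ∘ₗ
        TensorProduct.map LinearMap.id (antipode k)) (antipode k ∘ₗ antipode k)
  have hΨ (x y z : A) : Ψ ((x ⊗ₜ y) ⊗ₜ z) = antipode k (antipode k z) * (antipode k y * x) := by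
    simp [Ψ]
  let r := Coalgebra.Repr.arbitrary k a
  have key : ∑ i ∈ r.index, Ψ ((Q.R * Coalgebra.comul (R := k) (r.left i)) ⊗ₜ r.right i) =
      ∑ i ∈ r.index, Ψ ((TensorProduct.comm k A A (Coalgebra.comul (R := k) (r.left i)) * Q.R) ⊗ₜ
        r.right i) := by
    simp only [Q.intertwine]
  have hL (t : A ⊗[k] A) (z : A) : Ψ ((Q.R * t) ⊗ₜ z) =
      LinearMap.mul' k A (TensorProduct.comm k A A (TensorProduct.map (LinearMap.mulLeft k u)
        (antipode k ∘ₗ LinearMap.mul' k A ∘ₗ TensorProduct.map LinearMap.id (antipode k))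
        (TensorProduct.assoc k A A A (t ⊗ₜ z)))) := by
    induction t with
    | zero => simp
    | add x y hx hy => simp only [mul_add, TensorProduct.add_tmul, map_add, hx, hy]
    | tmul x y =>
      simp [hs, Finset.sum_mul, TensorProduct.sum_tmul, hΨ, hu,
        antipode_mul_antidistrib, mul_assoc]
  have hR (t : A ⊗[k] A) (z : A) : Ψ ((TensorProduct.comm k A A t * Q.R) ⊗ₜ z) =
      antipode k (antipode k z) * ∑ i ∈ s, antipode k i.2 * (LinearMap.mul' k A
        (TensorProduct.map (antipode k) LinearMap.id t)) * i.1 := by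
    induction t with
    | zero => simp
    | add x y hx hy =>
      simp only [add_mul, mul_add, TensorProduct.add_tmul, map_add, hx, hy, Finset.sum_add_distrib]
    | tmul x y =>
      simp [hs, Finset.mul_sum, TensorProduct.sum_tmul, hΨ,
        antipode_mul_antidistrib, mul_assoc]
  simp only [hL, hR, mul_antipode_left_apply] at key
  have hassoc := Coalgebra.coassoc_apply (R := k) a
  rw [← r.eq] at hassoc
  simp only [map_sum, LinearMap.rTensor_tmul, LinearMap.lTensor_tmul] at hassoc
  rw [← map_sum, ← map_sum, ← map_sum, hassoc] at key
  have hc := counit_right_apply (k := k) a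
  have hc' := counit_left_apply (k := k) a
  rw [← r.eq] at hc hc'
  simp only [map_sum, TensorProduct.map_tmul, LinearMap.id_apply, TensorProduct.rid_tmul,
    TensorProduct.lid_tmul] at hc hc'
  simp only [map_sum, TensorProduct.map_tmul, LinearMap.comp_apply, mul_antipode_right_apply,
    map_smul, antipode_one, TensorProduct.comm_tmul, LinearMap.mul'_apply, smul_mul_assoc,
    one_mul, LinearMap.mulLeft_apply, mul_smul_comm, mul_one, ← Finset.smul_sum, ← hu] at key
  rw [← hc, Finset.mul_sum]
  conv_lhs => rw [hc, ← hc']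
  simp only [map_sum, Finset.sum_mul, map_smul, mul_smul_comm, smul_mul_assoc]
  exact key.symm

lemma QuasiTriangular.counit_drinfeld : Coalgebra.counit (R := k) Q.drinfeld = 1 := by
  obtain ⟨s, hs⟩ := TensorProduct.exists_finset Q.R
  have h := congrArg (Coalgebra.counit (R := k)) (Q.sum_counit_smul_right hs)
  simpa [Q.drinfeld_eq_sum hs, map_sum, mul_comm] using h

variable {Q}

lemma QuasiTriangular.IsTriangular.comul_drinfeld (hQ : Q.IsTriangular) :
    Coalgebra.comul (R := k) Q.drinfeld = Q.drinfeld ⊗ₜ Q.drinfeld := by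
  obtain ⟨s, hs⟩ := TensorProduct.exists_finset Q.R
  have hu := Q.drinfeld_eq_sum hs
  have hconj := Q.drinfeld_mul
  set u := Q.drinfeld
  let K : (A ⊗[k] A) ⊗[k] (A ⊗[k] A) →ₗ[k] A ⊗[k] A := LinearMap.mul' k (A ⊗[k] A) ∘ₗ
    (TensorProduct.comm k _ _).toLinearMap ∘ₗ TensorProduct.map LinearMap.id
      (TensorProduct.map (antipode k) (antipode k) ∘ₗ (TensorProduct.comm k A A).toLinearMap)
  have hK (x y z w : A) : K ((x ⊗ₜ y) ⊗ₜ (z ⊗ₜ w)) =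
      (antipode k w * x) ⊗ₜ (antipode k z * y) := by simp [K]
  have h1 : Coalgebra.comul (R := k) u =
      ∑ i ∈ s, K (Coalgebra.comul (R := k) i.1 ⊗ₜ Coalgebra.comul (R := k) i.2) := by
    simp [hu, map_sum, K, comul_antipode]
  have h2 := Q.sum_hexagon₁ hs (K ∘ₗ TensorProduct.map LinearMap.id (Coalgebra.comul (R := k)))
  simp only [LinearMap.comp_apply, TensorProduct.map_tmul, LinearMap.id_apply,
    Bialgebra.comul_mul] at h2
  let B : (A ⊗[k] (A ⊗[k] A)) ⊗[k] (A ⊗[k] (A ⊗[k] A)) →ₗ[k] A ⊗[k] A :=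
    K ∘ₗ TensorProduct.map LinearMap.id (LinearMap.mul' k (A ⊗[k] A)) ∘ₗ
      (TensorProduct.tensorTensorTensorComm k A (A ⊗[k] A) A (A ⊗[k] A)).toLinearMap
  have hB (x x' : A) (y y' : A ⊗[k] A) :
      B ((x ⊗ₜ y) ⊗ₜ (x' ⊗ₜ y')) = K ((x ⊗ₜ x') ⊗ₜ (y * y')) := by simp [B]
  have h3 := Q.sum_hexagon₂ hs (LinearMap.id)
  simp only [LinearMap.id_apply] at h3
  have h4 : Coalgebra.comul (R := k) u = ∑ j' ∈ s, ∑ i' ∈ s, ∑ j ∈ s, ∑ i ∈ s,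
      (antipode k j.2 * (antipode k i.2 * i.1) * i'.1) ⊗ₜ
        (antipode k j'.2 * (antipode k i'.2 * j.1) * j'.1) := by
    have h5 := congrArg (fun t => B (t ⊗ₜ t)) h3
    simp only [TensorProduct.sum_tmul, TensorProduct.tmul_sum, map_sum, hB] at h5
    rw [h1, h2, Finset.sum_comm, h5]
    simp only [Algebra.TensorProduct.tmul_mul_tmul, hK, antipode_mul_antidistrib, mul_assoc]
    rw [Finset.sum_comm]
    refine Finset.sum_congr rfl fun _ _ => ?_
    exact (Finset.sum_congr rfl fun _ _ => Finset.sum_comm).trans Finset.sum_comm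
  have h6 (i' j' : A × A) : ∑ j ∈ s, ∑ i ∈ s,
      (antipode k j.2 * (antipode k i.2 * i.1) * i'.1) ⊗ₜ[k]
        (antipode k j'.2 * (antipode k i'.2 * j.1) * j'.1) =
      ∑ j ∈ s, TensorProduct.map (LinearMap.mulLeft k u)
        (LinearMap.mulLeft k (antipode k j'.2) ∘ₗ LinearMap.mulRight k j'.1)
        ((j.1 * i'.1) ⊗ₜ (antipode k i'.2 * j.2)) := by
    have h7 := congrArg (TensorProduct.map
      (LinearMap.mulLeft k (antipode k j'.2 * antipode k i'.2) ∘ₗ LinearMap.mulRight k j'.1)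
      (LinearMap.mulRight k (u * i'.1) ∘ₗ antipode k)) (hQ.sum_swap hs)
    have h8 := congrArg (TensorProduct.comm k A A) h7
    simp only [map_sum, TensorProduct.map_tmul, LinearMap.comp_apply, LinearMap.mulLeft_apply,
      LinearMap.mulRight_apply, TensorProduct.comm_tmul, ← mul_assoc, hconj] at h8
    simp only [← TensorProduct.sum_tmul, ← Finset.sum_mul, ← Finset.mul_sum, ← hu]
    simpa [← mul_assoc] using h8
  simp only [h4, h6, ← map_sum]
  have h9 := Q.sum_mul_tmul_antipode_mul hs
  rw [Finset.sum_comm] at h9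
  simp only [h9, Algebra.TensorProduct.one_def, TensorProduct.map_tmul, LinearMap.comp_apply,
    LinearMap.mulLeft_apply, LinearMap.mulRight_apply, mul_one, one_mul, ← TensorProduct.tmul_sum,
    ← hu]

lemma QuasiTriangular.IsTriangular.isGroupLikeElem_drinfeld (hQ : Q.IsTriangular) :
    IsGroupLikeElem k Q.drinfeld :=
  ⟨Q.counit_drinfeld, hQ.comul_drinfeld⟩

end DrinfeldProperties

section SplitBasic

variable {k} {B : Type w} [Ring B] [Algebra k B] [FiniteDimensional k B]

/-- If all simple quotients of a finite-dimensional algebra are one-dimensional, then the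
common kernel of its characters is contained in the Jacobson radical. -/
lemma mem_jacobson_of_forall_algHom
    (hB : ∀ (C : Type w) [Ring C] [IsSimpleRing C] [Algebra k C] (φ : B →ₐ[k] C),
      Function.Surjective φ → Module.finrank k C = 1)
    {x : B} (hx : ∀ χ : B →ₐ[k] k, χ x = 0) : x ∈ Ring.jacobson B := by
  have : IsArtinianRing B := .of_finite k B
  obtain ⟨n, D, d, _, _, _, hd, ⟨e⟩⟩ :=
    IsSemisimpleRing.exists_algEquiv_pi_matrix_divisionRing_finite k (B ⧸ Ring.jacobson B)
  rw [← Ideal.Quotient.eq_zero_iff_mem, ← map_eq_zero_iff e e.injective]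
  ext1 i
  let φ : B →ₐ[k] Matrix (Fin (d i)) (Fin (d i)) (D i) :=
    ((Pi.evalAlgHom k _ i).comp e.toAlgHom).comp (Ideal.Quotient.mkₐ k (Ring.jacobson B))
  have hφ : Function.Surjective φ :=
    (Function.surjective_eval i).comp (e.surjective.comp Ideal.Quotient.mk_surjective)
  have hb := Module.Free.bijective_algebraMap_of_finrank_eq_one (hB _ φ hφ)
  let f := AlgEquiv.ofBijective (Algebra.ofId k (Matrix (Fin (d i)) (Fin (d i)) (D i))) hb
  have h := hx (f.symm.toAlgHom.comp φ)
  exact (map_eq_zero_iff f.symm f.symm.injective).1 h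

lemma isNilpotent_of_mem_jacobson (k : Type*) [Field k] {B : Type*} [Ring B] [Algebra k B]
    [FiniteDimensional k B] {x : B} (hx : x ∈ Ring.jacobson B) : IsNilpotent x := by
  have : IsArtinianRing B := .of_finite k B
  obtain ⟨n, hn⟩ := IsSemiprimaryRing.isNilpotent (R := B)
  refine ⟨n, ?_⟩
  have := Ideal.pow_mem_pow hx n
  rwa [hn] at this

end SplitBasic

section Dual

open WithConv

variable {k} {A : Type v} [AddCommGroup A] [Module k A] [FiniteDimensional k A]

/-- Products of functionals separate the points of `A ⊗ A`. -/
lemma tensor_ext_dual {t t' : A ⊗[k] A}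
    (h : ∀ p q : Module.Dual k A, LinearMap.mul' k k (TensorProduct.map p q t) =
      LinearMap.mul' k k (TensorProduct.map p q t')) : t = t' := by
  let b := Module.finBasis k A
  refine (b.tensorProduct b).ext_elem fun ⟨i, j⟩ => ?_
  have key (t : A ⊗[k] A) : (b.tensorProduct b).repr t (i, j) =
      LinearMap.mul' k k (TensorProduct.map (b.coord i) (b.coord j) t) := by
    induction t with
    | zero => simp
    | add x y hx hy => simp only [map_add, Finsupp.add_apply, hx, hy]
    | tmul x y => simp [mul_comm]
  rw [key, key, h]

lemma convMul_apply_eq_zero_of_subcoalgebra {A : Type*} [AddCommGroup A] [Module k A]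
    [Coalgebra k A] {D : Submodule k A}
    (hD : IsSubcoalgebraOf k (Coalgebra.comul (R := k)) D) {p q : WithConv (A →ₗ[k] k)}
    (h : (∀ x ∈ D, p x = 0) ∨ ∀ x ∈ D, q x = 0) {x : A} (hx : x ∈ D) : (p * q) x = 0 := by
  obtain ⟨t, ht⟩ := hD x hx
  rw [LinearMap.convMul_apply, ← ht]
  clear ht
  induction t with
  | zero => simp
  | add x y hx hy => simp only [map_add, hx, hy, add_zero]
  | tmul x y =>
    rcases h with h | h
    · simp [show p.ofConv (x : A) = 0 from h x x.2]
    · simp [show q.ofConv (y : A) = 0 from h y y.2]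

variable [Coalgebra k A]

lemma isSubcoalgebraOf_of_ideal {D : Submodule k A}
    (hl : ∀ p q : WithConv (A →ₗ[k] k), (∀ x ∈ D, q x = 0) → ∀ x ∈ D, (p * q) x = 0)
    (hr : ∀ p q : WithConv (A →ₗ[k] k), (∀ x ∈ D, p x = 0) → ∀ x ∈ D, (p * q) x = 0) :
    IsSubcoalgebraOf k (Coalgebra.comul (R := k)) D := by
  obtain ⟨g, hg⟩ := D.subtype.exists_leftInverse_of_injective D.ker_subtype
  intro x hx
  refine ⟨TensorProduct.map g g (Coalgebra.comul x), tensor_ext_dual fun p q => ?_⟩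
  let π : A →ₗ[k] A := D.subtype ∘ₗ g
  have hπ (y : A) (hy : y ∈ D) : π y = y := congrArg Subtype.val (LinearMap.congr_fun hg ⟨y, hy⟩)
  have h1 := hr (toConv (p - p ∘ₗ π)) (toConv q) (fun y hy => by
    change p y - p (π y) = 0
    rw [hπ y hy, sub_self]) x hx
  have h2 := hl (toConv (p ∘ₗ π)) (toConv (q - q ∘ₗ π)) (fun y hy => by
    change q y - q (π y) = 0
    rw [hπ y hy, sub_self]) x hx
  have h3 (t : A ⊗[k] A) : LinearMap.mul' k k (TensorProduct.map p q
      (TensorProduct.map D.subtype D.subtype (TensorProduct.map g g t))) =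
      LinearMap.mul' k k (TensorProduct.map p q t) -
        LinearMap.mul' k k (TensorProduct.map (p - p ∘ₗ π) q t) -
        LinearMap.mul' k k (TensorProduct.map (p ∘ₗ π) (q - q ∘ₗ π) t) := by
    induction t with
    | zero => simp
    | add x y hx hy => simp only [map_add, hx, hy]; ring
    | tmul x y => simp [π]; ring
  rw [h3, show LinearMap.mul' k k (TensorProduct.map (p - p ∘ₗ π) q _) = 0 from h1,
    show LinearMap.mul' k k (TensorProduct.map (p ∘ₗ π) (q - q ∘ₗ π) _) = 0 from h2]
  simp

/-- The simple quotients of the dual algebra of a pointed coalgebra are one-dimensional. -/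
lemma finrank_eq_one_of_isPointedOf (hA : IsPointedOf k (Coalgebra.comul (R := k) (A := A)))
    {C : Type w} [Ring C] [IsSimpleRing C] [Algebra k C] (φ : WithConv (A →ₗ[k] k) →ₐ[k] C)
    (hφ : Function.Surjective φ) : Module.finrank k C = 1 := by
  let ψ : Module.Dual k A →ₗ[k] C := φ.toLinearMap ∘ₗ (WithConv.linearEquiv k _).symm.toLinearMap
  have hψ : Function.Surjective ψ := fun c => by
    obtain ⟨p, rfl⟩ := hφ c
    exact ⟨p.ofConv, rfl⟩
  let D := (LinearMap.ker ψ).dualCoannihilator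
  have hDK : D.dualAnnihilator = LinearMap.ker ψ := Subspace.dualCoannihilator_dualAnnihilator_eq
  have hmem (p : WithConv (A →ₗ[k] k)) : (∀ x ∈ D, p x = 0) ↔ φ p = 0 := by
    rw [← Submodule.mem_dualAnnihilator, hDK]
    rfl
  have hD : IsSubcoalgebraOf k (Coalgebra.comul (R := k)) D :=
    isSubcoalgebraOf_of_ideal (fun p q h => by rw [hmem] at h ⊢; rw [map_mul, h, mul_zero])
      (fun p q h => by rw [hmem] at h ⊢; rw [map_mul, h, zero_mul])
  have hsimple : IsSimpleSubcoalgebraOf k (Coalgebra.comul (R := k)) D := by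
    refine ⟨fun h0 => ?_, hD, fun D' hD' hle => ?_⟩
    · have := (hmem 1).1 (fun x hx => by
        rw [h0, Submodule.mem_bot] at hx
        rw [hx, map_zero])
      simp at this
    · let J : TwoSidedIdeal C := .mk' {c | ∃ p : WithConv (A →ₗ[k] k), (∀ x ∈ D', p x = 0) ∧ φ p = c}
        ⟨0, by simp, by simp⟩
        (by
          rintro _ _ ⟨p, hp, rfl⟩ ⟨q, hq, rfl⟩
          exact ⟨p + q, fun x hx => by simp [hp x hx, hq x hx], map_add _ _ _⟩)
        (by
          rintro _ ⟨p, hp, rfl⟩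
          exact ⟨-p, fun x hx => by simp [hp x hx], map_neg _ _⟩)
        (by
          rintro a _ ⟨p, hp, rfl⟩
          obtain ⟨q, rfl⟩ := hφ a
          exact ⟨q * p, fun x hx => convMul_apply_eq_zero_of_subcoalgebra hD' (.inr hp) hx,
            map_mul _ _ _⟩)
        (by
          rintro _ a ⟨p, hp, rfl⟩
          obtain ⟨q, rfl⟩ := hφ a
          exact ⟨p * q, fun x hx => convMul_apply_eq_zero_of_subcoalgebra hD' (.inl hp) hx,
            map_mul _ _ _⟩)
      have hJ (c : C) : c ∈ J ↔ ∃ p : WithConv (A →ₗ[k] k), (∀ x ∈ D', p x = 0) ∧ φ p = c := by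
        simp [J, TwoSidedIdeal.mem_mk']
      rcases eq_bot_or_eq_top J with h | h
      · right
        refine le_antisymm hle ?_
        rw [← Subspace.dualAnnihilator_le_dualAnnihilator_iff]
        intro p hp
        rw [Submodule.mem_dualAnnihilator] at hp ⊢
        refine (hmem (toConv p)).2 ?_
        rw [← TwoSidedIdeal.mem_bot, ← h, hJ]
        exact ⟨_, hp, rfl⟩
      · left
        obtain ⟨p, hp, hp1⟩ := (hJ 1).1 (h ▸ trivial)
        have h1 : ∀ x ∈ D', (1 : WithConv (A →ₗ[k] k)) x = 0 := fun x hx => by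
          have := (hmem (1 - p)).2 (by simp [hp1]) x (hle hx)
          simpa [hp x hx] using this
        rw [eq_bot_iff]
        intro x hx
        rw [Submodule.mem_bot, ← Module.forall_dual_apply_eq_zero_iff k]
        intro q
        have := convMul_apply_eq_zero_of_subcoalgebra hD' (q := toConv q) (.inl h1) hx
        rwa [one_mul] at this
  have h1 := hA D hsimple
  have h2 := Subspace.finrank_add_finrank_dualCoannihilator_eq (LinearMap.ker ψ)
  have h3 := LinearMap.finrank_range_add_finrank_ker ψ
  rw [LinearMap.range_eq_top.2 hψ, finrank_top, Subspace.dual_finrank_eq] at h3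
  change _ + Module.finrank k D = _ at h2
  omega

end Dual

section MinimalPart

open HopfAlgebra WithConv

variable {k} {A : Type v} [Ring A] [HopfAlgebra k A] (Q : QuasiTriangular k A)

/-- The algebra homomorphism `p ↦ (p ⊗ id)(R)` from the dual algebra. -/
def QuasiTriangular.dualAlgHom : WithConv (A →ₗ[k] k) →ₐ[k] A :=
  AlgHom.ofLinearMap
    { toFun := fun p => TensorProduct.lid k A (TensorProduct.map p.ofConv LinearMap.id Q.R)
      map_add' := fun p q => by simp [TensorProduct.map_add_left]
      map_smul' := fun c p => by simp [TensorProduct.map_smul_left] }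
    (by
      obtain ⟨s, hs⟩ := TensorProduct.exists_finset Q.R
      simpa [hs, map_sum] using Q.sum_counit_smul_right hs)
    (fun p q => by
      obtain ⟨s, hs⟩ := TensorProduct.exists_finset Q.R
      have h := Q.sum_hexagon₁ hs ((TensorProduct.lid k A).toLinearMap ∘ₗ
        TensorProduct.map (LinearMap.mul' k k ∘ₗ TensorProduct.map p.ofConv q.ofConv) LinearMap.id)
      simpa [hs, map_sum, Finset.sum_mul_sum, smul_smul, mul_comm] using h)

lemma QuasiTriangular.dualAlgHom_apply (p : WithConv (A →ₗ[k] k)) :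
    Q.dualAlgHom p = TensorProduct.lid k A (TensorProduct.map p.ofConv LinearMap.id Q.R) := rfl

variable {Q}

lemma QuasiTriangular.IsTriangular.right_eq (hQ : Q.IsTriangular) (p : A →ₗ[k] k) :
    TensorProduct.rid k A (TensorProduct.map LinearMap.id p Q.R) =
      Q.dualAlgHom (toConv (p ∘ₗ antipode k)) := by
  have h := congrArg (fun t => TensorProduct.lid k A (TensorProduct.map p LinearMap.id t))
    hQ.antipode_left
  obtain ⟨s, hs⟩ := TensorProduct.exists_finset Q.R
  simpa [hs, map_sum, Q.dualAlgHom_apply] using h.symm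

lemma QuasiTriangular.IsTriangular.antipode_right (hQ : Q.IsTriangular) (p : A →ₗ[k] k) :
    antipode k (TensorProduct.rid k A (TensorProduct.map LinearMap.id p Q.R)) =
      Q.dualAlgHom (toConv p) := by
  have h := congrArg (fun t => TensorProduct.rid k A (TensorProduct.map LinearMap.id p t))
    hQ.antipode_left
  obtain ⟨s, hs⟩ := TensorProduct.exists_finset Q.R
  simpa [hs, map_sum, Q.dualAlgHom_apply] using h

variable [FiniteDimensional k A]

lemma QuasiTriangular.IsTriangular.antipode_mem_range (hQ : Q.IsTriangular) {x : A}
    (hx : x ∈ Q.dualAlgHom.range) : antipode k x ∈ Q.dualAlgHom.range := by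
  let G : (A →ₗ[k] k) →ₗ[k] A :=
    { toFun := fun p => TensorProduct.rid k A (TensorProduct.map LinearMap.id p Q.R)
      map_add' := fun p q => by simp [TensorProduct.map_add_right]
      map_smul' := fun c p => by simp [TensorProduct.map_smul_right] }
  have h1 : LinearMap.range G ≤ Subalgebra.toSubmodule Q.dualAlgHom.range := by
    rintro _ ⟨p, rfl⟩
    exact ⟨_, (hQ.right_eq p).symm⟩
  have h2 : Subalgebra.toSubmodule Q.dualAlgHom.range = (LinearMap.range G).map (antipode k) := by
    ext y
    constructor
    · rintro ⟨p, rfl⟩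
      exact ⟨_, ⟨p.ofConv, rfl⟩, hQ.antipode_right p.ofConv⟩
    · rintro ⟨_, ⟨p, rfl⟩, rfl⟩
      exact ⟨_, (hQ.antipode_right p).symm⟩
  have h3 : LinearMap.range G = Subalgebra.toSubmodule Q.dualAlgHom.range :=
    Submodule.eq_of_le_of_finrank_le h1 (by rw [h2]; exact Submodule.finrank_map_le _ _)
  have hx' : x ∈ LinearMap.range G := h3 ▸ hx
  rw [← Subalgebra.mem_toSubmodule, h2]
  exact ⟨x, hx', rfl⟩

lemma mem_range_map_subtype_of_forall {A : Type*} [AddCommGroup A] [Module k A]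
    [FiniteDimensional k A] {D : Submodule k A} {t : A ⊗[k] A}
    (hl : ∀ p : A →ₗ[k] k, TensorProduct.lid k A (TensorProduct.map p LinearMap.id t) ∈ D)
    (hr : ∀ p : A →ₗ[k] k, TensorProduct.rid k A (TensorProduct.map LinearMap.id p t) ∈ D) :
    t ∈ LinearMap.range (TensorProduct.map D.subtype D.subtype) := by
  obtain ⟨g, hg⟩ := D.subtype.exists_leftInverse_of_injective D.ker_subtype
  refine ⟨TensorProduct.map g g t, tensor_ext_dual fun p q => ?_⟩
  let π : A →ₗ[k] A := D.subtype ∘ₗ g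
  have hπ (y : A) (hy : y ∈ D) : π y = y := congrArg Subtype.val (LinearMap.congr_fun hg ⟨y, hy⟩)
  have h1 (p q : A →ₗ[k] k) : LinearMap.mul' k k (TensorProduct.map p q t) =
      q (TensorProduct.lid k A (TensorProduct.map p LinearMap.id t)) := by
    clear hl hr
    induction t with
    | zero => simp
    | add x y hx hy => simp only [map_add, hx, hy]
    | tmul x y => simp
  have h2 (p q : A →ₗ[k] k) : LinearMap.mul' k k (TensorProduct.map p q t) =
      p (TensorProduct.rid k A (TensorProduct.map LinearMap.id q t)) := by
    clear hl hr h1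
    induction t with
    | zero => simp
    | add x y hx hy => simp only [map_add, hx, hy]
    | tmul x y => simp [mul_comm]
  have h3 : LinearMap.mul' k k (TensorProduct.map p q (TensorProduct.map D.subtype D.subtype
      (TensorProduct.map g g t))) =
      LinearMap.mul' k k (TensorProduct.map (p ∘ₗ π) (q ∘ₗ π) t) := by
    clear hl hr h1 h2
    induction t with
    | zero => simp
    | add x y hx hy => simp only [map_add, hx, hy]
    | tmul x y => simp [π]
  rw [h3, h2, LinearMap.comp_apply, hπ _ (hr _), ← h2, h1, LinearMap.comp_apply, hπ _ (hl _), ← h1]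

/-- The tensor `R` has a presentation with components in the image of the dual algebra. -/
lemma QuasiTriangular.IsTriangular.exists_sum_range (hQ : Q.IsTriangular) :
    ∃ s : Finset (Q.dualAlgHom.range × Q.dualAlgHom.range),
      Q.R = ∑ i ∈ s, (i.1 : A) ⊗ₜ[k] (i.2 : A) := by
  obtain ⟨r, hr⟩ := mem_range_map_subtype_of_forall
    (D := Subalgebra.toSubmodule Q.dualAlgHom.range) (t := Q.R)
    (fun p => ⟨toConv p, rfl⟩) (fun p => ⟨_, (hQ.right_eq p).symm⟩)
  obtain ⟨s, hs⟩ := TensorProduct.exists_finset r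
  refine ⟨s, ?_⟩
  rw [← hr, hs]
  simp only [map_sum, TensorProduct.map_tmul]
  rfl

/-- Every character of the image of the dual algebra takes the value `±1` at the Drinfeld
element. -/
lemma QuasiTriangular.IsTriangular.exists_drinfeld_sq (hQ : Q.IsTriangular) :
    ∃ u : Q.dualAlgHom.range, (u : A) = Q.drinfeld ∧ ∀ χ : Q.dualAlgHom.range →ₐ[k] k,
      χ (u * u - 1) = 0 := by
  classical
  obtain ⟨s, hs⟩ := hQ.exists_sum_range
  let B := Q.dualAlgHom.range
  let σ (x : B) : B := ⟨antipode k x, hQ.antipode_mem_range x.2⟩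
  let e : B × B ↪ A × A := ⟨fun x => (x.1, x.2), fun x y h => by
    simpa [Prod.ext_iff] using h⟩
  have hs' : Q.R = ∑ i ∈ s.map e, i.1 ⊗ₜ[k] i.2 := by
    rw [hs, Finset.sum_map]
    rfl
  have hinj : Function.Injective (Algebra.TensorProduct.map B.val B.val) := by
    exact TensorProduct.map_injective_of_flat_flat' _ _ Subtype.val_injective Subtype.val_injective
  refine ⟨∑ i ∈ s, σ i.2 * i.1, ?_, fun χ => ?_⟩
  · rw [Q.drinfeld_eq_sum hs', Finset.sum_map]
    simp only [σ, AddSubmonoidClass.coe_finsetSum, MulMemClass.coe_mul]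
    rfl
  let X : B ⊗[k] B →ₐ[k] k := Algebra.TensorProduct.lift χ χ fun _ _ => .all _ _
  have h1 := hQ
  rw [QuasiTriangular.IsTriangular, hs] at h1
  have h2 : (∑ i ∈ s, i.1 ⊗ₜ[k] i.2) * (∑ i ∈ s, i.2 ⊗ₜ[k] i.1) = (1 : B ⊗[k] B) := by
    apply hinj
    simpa [map_sum, map_mul] using h1
  have h3 : ∑ i ∈ s, ∑ j ∈ s, (i.1 * j.1) ⊗ₜ[k] (σ j.2 * i.2) = (1 : B ⊗[k] B) := by
    apply hinj
    have := Q.sum_mul_tmul_antipode_mul hs'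
    rw [map_one, ← this]
    simp only [map_sum, Finset.sum_map, Algebra.TensorProduct.map_tmul, map_mul]
    rfl
  have h4 := congrArg X h2
  have h5 := congrArg X h3
  have h6 : χ (∑ i ∈ s, σ i.2 * i.1) = ∑ i ∈ s, χ (σ i.2) * χ i.1 := by simp [map_sum]
  have h7 : (∑ i ∈ s, χ i.1 * χ i.2) * (∑ i ∈ s, χ (σ i.2) * χ i.1) = 1 := by
    simp only [X, map_sum, Algebra.TensorProduct.lift_tmul, map_mul, map_one] at h5
    rw [← h5, Finset.sum_mul_sum]
    exact Finset.sum_congr rfl fun i _ => Finset.sum_congr rfl fun j _ => by ring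
  have h8 : (∑ i ∈ s, χ i.1 * χ i.2) * (∑ i ∈ s, χ i.1 * χ i.2) = 1 := by
    simp only [X, map_mul, map_sum, Algebra.TensorProduct.lift_tmul, map_one] at h4
    rw [← h4]
    exact congrArg (_ * ·) (Finset.sum_congr rfl fun i _ => mul_comm _ _)
  rw [map_sub, map_mul, h6, map_one]
  rw [← mul_left_cancel₀ (left_ne_zero_of_mul_eq_one h8) (h8.trans h7.symm), h8, sub_self]

lemma eq_one_of_isNilpotent_of_pow_eq_one [CharZero k] {A : Type*} [Ring A] [Algebra k A] {h : A}
    (hn : IsNilpotent (h - 1)) {m : ℕ} (hm : 0 < m) (hpow : h ^ m = 1) : h = 1 := by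
  obtain ⟨q, hq⟩ := Polynomial.X_sub_C_dvd_sub_C_eval (a := (1 : k))
    (p := ∑ i ∈ Finset.range m, Polynomial.X ^ i)
  have h1 := congrArg (Polynomial.aeval h) hq
  simp only [Polynomial.eval_finsetSum, Polynomial.eval_pow, Polynomial.eval_X, one_pow,
    Finset.sum_const, Finset.card_range, map_sub, map_sum, map_pow, Polynomial.aeval_X,
    map_mul, Polynomial.aeval_C, map_one] at h1
  have hc : Commute (h - 1) (Polynomial.aeval h q) := by
    have := (Commute.all (Polynomial.X - Polynomial.C 1) q).map (Polynomial.aeval h)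
    rwa [map_sub, Polynomial.aeval_X, Polynomial.aeval_C, map_one] at this
  have h2 := geom_sum_mul h m
  rw [hpow, sub_self] at h2
  have h3 : IsUnit (∑ i ∈ Finset.range m, h ^ i) := by
    rw [sub_eq_iff_eq_add'] at h1
    rw [h1]
    refine IsNilpotent.isUnit_add_left_of_commute (hc.isNilpotent_mul_right hn) ?_ ?_
    · refine IsUnit.map (algebraMap k A) ?_
      simpa using hm.ne'
    · exact (Algebra.commute_algebraMap_left _ _).symm
  exact sub_eq_zero.1 (h3.mul_right_eq_zero.1 h2)

/-- The Drinfeld element of a triangular pointed Hopf algebra is an involution. -/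
lemma QuasiTriangular.IsTriangular.drinfeld_mul_self [CharZero k] (hQ : Q.IsTriangular)
    (hA : IsPointed k A) : Q.drinfeld * Q.drinfeld = 1 := by
  obtain ⟨u, hu, hχ⟩ := hQ.exists_drinfeld_sq
  have h1 : u * u - 1 ∈ Ring.jacobson Q.dualAlgHom.range :=
    mem_jacobson_of_forall_algHom (k := k) (fun C _ _ _ φ hφ =>
      finrank_eq_one_of_isPointedOf hA (φ.comp Q.dualAlgHom.rangeRestrict)
        (hφ.comp Q.dualAlgHom.rangeRestrict_surjective)) hχ
  have h2 := (isNilpotent_of_mem_jacobson k h1).map Q.dualAlgHom.range.val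
  have : Finite (GroupLike k A) := (linearIndep_groupLikeVal (R := k) (A := A)).finite
  let g : GroupLike k A := ⟨Q.drinfeld, hQ.isGroupLikeElem_drinfeld⟩
  obtain ⟨m, hm, hg⟩ := (isOfFinOrder_of_finite (g * g)).exists_pow_eq_one
  refine eq_one_of_isNilpotent_of_pow_eq_one (k := k) (by simpa [hu] using h2) hm ?_
  simpa using congrArg GroupLike.val hg

end MinimalPart

section Traces

open HopfAlgebra WithConv

variable {k} {A : Type v} [Ring A] [HopfAlgebra k A]

lemma antipode_antipode_comul (a : A) :
    Coalgebra.comul (R := k) (antipode k (antipode k a)) =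
      TensorProduct.map (antipode k ∘ₗ antipode k) (antipode k ∘ₗ antipode k)
        (Coalgebra.comul (R := k) a) := by
  rw [comul_antipode, comul_antipode]
  generalize Coalgebra.comul (R := k) a = t
  induction t with
  | zero => simp
  | add x y hx hy => simp only [map_add, hx, hy]
  | tmul x y => simp

variable [FiniteDimensional k A]

/-- The trace of the left multiplication by a grouplike element is either `0` or `dim A`. -/
lemma trace_mulLeft_mul_self {h : A} (hh : IsGroupLikeElem k h) :
    LinearMap.trace k A (LinearMap.mulLeft k h) * LinearMap.trace k A (LinearMap.mulLeft k h) =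
      LinearMap.trace k A (LinearMap.mulLeft k h) * Module.finrank k A := by
  let C (f : A →ₗ[k] A ⊗[k] A) : A ⊗[k] A →ₗ[k] A ⊗[k] A :=
    TensorProduct.map LinearMap.id (LinearMap.mul' k A) ∘ₗ
      (TensorProduct.assoc k A A A).toLinearMap ∘ₗ f.rTensor A
  let F := C Coalgebra.comul
  let G := C (TensorProduct.map LinearMap.id (antipode k) ∘ₗ Coalgebra.comul)
  have hFG : F ∘ₗ G = LinearMap.id := by
    ext a b
    let Φ : A ⊗[k] (A ⊗[k] A) →ₗ[k] A ⊗[k] A := TensorProduct.map LinearMap.id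
      (LinearMap.mulRight k b ∘ₗ LinearMap.mul' k A ∘ₗ TensorProduct.map LinearMap.id (antipode k))
    have h1 (t : A ⊗[k] A) (z : A) : TensorProduct.map LinearMap.id (LinearMap.mul' k A)
        (TensorProduct.assoc k A A A (t ⊗ₜ (antipode k z * b))) =
          Φ (TensorProduct.assoc k A A A (t ⊗ₜ z)) := by
      induction t with
      | zero => simp
      | add x y hx hy => simp only [TensorProduct.add_tmul, map_add, hx, hy]
      | tmul x y => simp [Φ, mul_assoc]
    have h2 (t : A ⊗[k] A) : F (TensorProduct.map LinearMap.id (LinearMap.mul' k A)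
        (TensorProduct.assoc k A A A (TensorProduct.map LinearMap.id (antipode k) t ⊗ₜ b))) =
          Φ (TensorProduct.assoc k A A A (Coalgebra.comul.rTensor A t)) := by
      induction t with
      | zero => simp
      | add x y hx hy => simp only [TensorProduct.add_tmul, map_add, hx, hy]
      | tmul x z => simp [F, C, h1]
    have h3 (t : A ⊗[k] A) : Φ (Coalgebra.comul.lTensor A t) =
        TensorProduct.rid k A (TensorProduct.map LinearMap.id (Coalgebra.counit (R := k)) t) ⊗ₜ b := by
      induction t with
      | zero => simp
      | add x y hx hy => simp only [TensorProduct.add_tmul, map_add, hx, hy]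
      | tmul x z => simp [Φ, mul_antipode_right_apply, TensorProduct.smul_tmul]
    have h4 := h2 (Coalgebra.comul a)
    rw [Coalgebra.coassoc_apply, h3, counit_right_apply] at h4
    simpa [G, C] using h4
  have hGF : G ∘ₗ F = LinearMap.id := (LinearMap.comp_eq_id_comm k _).1 hFG
  let L := LinearMap.mulLeft k h
  have hcomm : F ∘ₗ TensorProduct.map L LinearMap.id = TensorProduct.map L L ∘ₗ F := by
    ext a b
    simp only [TensorProduct.AlgebraTensorModule.curry_apply, TensorProduct.curry_apply,
      LinearMap.coe_restrictScalars, LinearMap.comp_apply, TensorProduct.map_tmul,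
      LinearMap.id_apply, F, C, LinearMap.rTensor_tmul, LinearEquiv.coe_coe, L,
      LinearMap.mulLeft_apply, Bialgebra.comul_mul, hh.comul_eq_tmul_self]
    generalize Coalgebra.comul (R := k) a = t
    induction t with
    | zero => simp
    | add x y hx hy => simp only [mul_add, TensorProduct.add_tmul, map_add, hx, hy]
    | tmul x y => simp [mul_assoc]
  have h1 : LinearMap.trace k _ (TensorProduct.map L L) =
      LinearMap.trace k _ (TensorProduct.map L (LinearMap.id (M := A))) := by
    calc LinearMap.trace k _ (TensorProduct.map L L)
        = LinearMap.trace k _ ((TensorProduct.map L L ∘ₗ F) ∘ₗ G) := by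
          rw [LinearMap.comp_assoc, hFG, LinearMap.comp_id]
      _ = LinearMap.trace k _ (G ∘ₗ (F ∘ₗ TensorProduct.map L LinearMap.id)) := by
          rw [← hcomm, LinearMap.trace_comp_comm']
      _ = _ := by rw [← LinearMap.comp_assoc, hGF, LinearMap.id_comp]
  rwa [LinearMap.trace_tensorProduct', LinearMap.trace_tensorProduct', LinearMap.trace_id] at h1

/-- A grouplike involution `u ≠ 1` acts with trace zero. -/
lemma trace_mulLeft_eq_zero [CharZero k] {u : A} (hu : IsGroupLikeElem k u) (huu : u * u = 1)
    (hu1 : u ≠ 1) : LinearMap.trace k A (LinearMap.mulLeft k u) = 0 := by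
  by_contra h
  have h1 := mul_left_cancel₀ h (trace_mulLeft_mul_self hu)
  let e : A →ₗ[k] A := (2⁻¹ : k) • (1 - LinearMap.mulLeft k u)
  have he : IsIdempotentElem e := by
    ext a
    have : u * (u * a) = a := by rw [← mul_assoc, huu, one_mul]
    simp only [e, Module.End.mul_apply, LinearMap.smul_apply, LinearMap.sub_apply,
      Module.End.one_apply, LinearMap.mulLeft_apply, mul_smul_comm, mul_sub, this]
    module
  have h2 : LinearMap.trace k A e = 0 := by
    simp only [e, map_smul, map_sub, h1, LinearMap.trace_one, sub_self, smul_zero]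
  rw [LinearMap.IsIdempotentElem.trace_eq_zero_iff he] at h2
  have h3 := LinearMap.congr_fun h2 1
  simp only [e, LinearMap.smul_apply, LinearMap.sub_apply, Module.End.one_apply,
    LinearMap.mulLeft_apply, mul_one, LinearMap.zero_apply] at h3
  rw [smul_eq_zero_iff_right (by norm_num), sub_eq_zero] at h3
  exact hu1 h3.symm

/-- If `u` implements the square of the antipode, is a grouplike involution and is not `1`,
then the dimension is divisible by four as soon as the trace of `S²` vanishes. -/
lemma four_dvd_finrank [CharZero k] {u : A} (hu : IsGroupLikeElem k u) (huu : u * u = 1)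
    (hconj : ∀ a : A, antipode k (antipode k a) * u = u * a)
    (htr : LinearMap.trace k A (antipode k ∘ₗ antipode k) = 0) : 4 ∣ Module.finrank k A := by
  have hS (a : A) : antipode k (antipode k a) = u * a * u := by
    rw [← hconj, mul_assoc, huu, mul_one]
  have hSu : antipode k u = u := by
    rw [← mul_one (antipode k u), ← huu, ← mul_assoc, hu.antipode_mul_cancel, one_mul]
  let L := LinearMap.mulLeft k u
  let R := LinearMap.mulRight k u
  have hLL : L * L = 1 := by ext a; simp [L, ← mul_assoc, huu]
  have hRR : R * R = 1 := by ext a; simp [R, mul_assoc, huu]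
  have hLR : L * R = R * L := by ext a; simp [L, R, mul_assoc]
  have hLRS : L * R = antipode k ∘ₗ antipode k := by ext a; simp [L, R, hS, mul_assoc]
  rcases subsingleton_or_nontrivial A with hA | hA
  · simp [Module.finrank_zero_of_subsingleton]
  have hu1 : u ≠ 1 := by
    rintro rfl
    have : antipode k ∘ₗ antipode k = LinearMap.id (R := k) (M := A) := by ext a; simp [hS]
    rw [this, LinearMap.trace_id] at htr
    exact Module.finrank_pos.ne' (Nat.cast_eq_zero.1 htr)
  have hL : LinearMap.trace k A L = 0 := trace_mulLeft_eq_zero hu huu hu1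
  have hR : LinearMap.trace k A R = 0 := by
    have h1 : L ∘ₗ antipode k = antipode k ∘ₗ R := by
      ext a
      simp [L, R, antipode_mul_antidistrib, hSu]
    have h2 : (antipode k ∘ₗ antipode k) ∘ₗ (antipode k ∘ₗ antipode k) = (1 : A →ₗ[k] A) := by
      rw [← hLRS]
      change L * R * (L * R) = 1
      nth_rewrite 1 [hLR]
      rw [mul_assoc, ← mul_assoc L, hLL, one_mul, hRR]
    calc LinearMap.trace k A R
        = LinearMap.trace k A (((antipode k ∘ₗ antipode k) ∘ₗ (antipode k ∘ₗ antipode k)) ∘ₗ R) := by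
          rw [h2]
          rfl
      _ = LinearMap.trace k A ((antipode k ∘ₗ antipode k ∘ₗ antipode k) ∘ₗ (L ∘ₗ antipode k)) := by
          rw [h1]
          rfl
      _ = LinearMap.trace k A (((antipode k ∘ₗ antipode k) ∘ₗ (antipode k ∘ₗ antipode k)) ∘ₗ L) := by
          rw [← LinearMap.comp_assoc, LinearMap.trace_comp_comm']
          rfl
      _ = 0 := by rw [h2]; exact hL
  let e : A →ₗ[k] A := (4⁻¹ : k) • ((1 + L) * (1 + R))
  have he : IsIdempotentElem e := by
    have h1 : ((1 + L) * (1 + R)) * ((1 + L) * (1 + R)) = (4 : k) • ((1 + L) * (1 + R)) := by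
      calc ((1 + L) * (1 + R)) * ((1 + L) * (1 + R))
          = (1 + L + L + L * L) * (1 + R + R + R * R) := by
            have : (1 + R) * (1 + L) = (1 + L) * (1 + R) := by
              simp only [mul_add, add_mul, one_mul, mul_one, hLR]
              abel
            rw [mul_assoc, ← mul_assoc (1 + R), this, ← mul_assoc, ← mul_assoc, mul_assoc]
            congr 1 <;> simp only [mul_add, add_mul, one_mul, mul_one] <;> abel
        _ = _ := by
          rw [hLL, hRR]
          simp only [mul_add, add_mul, one_mul, mul_one]
          module
    simp only [IsIdempotentElem, e, smul_mul_smul_comm, h1, smul_smul]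
    norm_num
  have h2 : LinearMap.trace k A e = 4⁻¹ * Module.finrank k A := by
    have : (1 + L) * (1 + R) = 1 + L + R + L * R := by
      simp only [mul_add, add_mul, one_mul, mul_one]
      abel
    simp only [e, this, map_smul, map_add, hL, hR, hLRS, htr, LinearMap.trace_one]
    simp
  have h3 := (LinearMap.IsIdempotentElem.isProj_range e he).trace
  rw [h2, inv_mul_eq_iff_eq_mul₀ (by norm_num)] at h3
  exact ⟨_, by exact_mod_cast h3⟩

end Traces

section Integral

open HopfAlgebra WithConv

variable {k} {A : Type v} [Ring A] [HopfAlgebra k A]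

/-- The map `a ↦ p(a₁) S²(a₂)` attached to a linear form `p`. -/
def twist (p : A →ₗ[k] k) : A →ₗ[k] A :=
  (TensorProduct.lid k A).toLinearMap ∘ₗ
    TensorProduct.map p (antipode k ∘ₗ antipode k) ∘ₗ Coalgebra.comul

variable (k A) in
/-- The linear form `p ↦ Tr (a ↦ p(a₁) S²(a₂))` on the dual. -/
def traceTwist : (A →ₗ[k] k) →ₗ[k] k where
  toFun p := LinearMap.trace k A (twist p)
  map_add' p q := by
    simp only [twist, TensorProduct.map_add_left, LinearMap.add_comp, LinearMap.comp_add, map_add]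
  map_smul' c p := by
    simp only [twist, TensorProduct.map_smul_left, LinearMap.smul_comp, LinearMap.comp_smul,
      map_smul, RingHom.id_apply]

lemma twist_counit : twist (Coalgebra.counit (R := k) (A := A)) = antipode k ∘ₗ antipode k := by
  ext a
  have h (t : A ⊗[k] A) : TensorProduct.lid k A (TensorProduct.map (Coalgebra.counit (R := k))
      (antipode k ∘ₗ antipode k) t) = antipode k (antipode k (TensorProduct.lid k A
        (TensorProduct.map (Coalgebra.counit (R := k)) LinearMap.id t))) := by
    induction t with
    | zero => simp
    | add x y hx hy => simp only [map_add, hx, hy]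
    | tmul x y => simp
  simp only [twist, LinearMap.comp_apply, LinearEquiv.coe_coe]
  rw [h, counit_left_apply]

lemma sum_antipode_mul_comul_mul (p : A →ₗ[k] k) (h : A) (w : A ⊗[k] A)
    {ι : Type*} (r : Coalgebra.Repr k h ι) :
    ∑ i ∈ r.index, antipode k (r.right i) * TensorProduct.lid k A
        (TensorProduct.map p (antipode k ∘ₗ antipode k) (Coalgebra.comul (R := k) (r.left i) * w)) =
      TensorProduct.lid k A (TensorProduct.map (p ∘ₗ LinearMap.mulLeft k h)
        (antipode k ∘ₗ antipode k) w) := by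
  induction w with
  | zero => simp
  | add x y hx hy => simp only [mul_add, map_add, Finset.sum_add_distrib, hx, hy]
  | tmul c d =>
    let Ω : A ⊗[k] (A ⊗[k] A) →ₗ[k] A := (TensorProduct.lid k A).toLinearMap ∘ₗ
      TensorProduct.map (p ∘ₗ LinearMap.mulRight k c)
        (LinearMap.mulRight k (antipode k (antipode k d)) ∘ₗ antipode k ∘ₗ LinearMap.mul' k A ∘ₗ
          TensorProduct.map (antipode k) LinearMap.id)
    have h1 (t : A ⊗[k] A) (y : A) : antipode k y * TensorProduct.lid k A
        (TensorProduct.map p (antipode k ∘ₗ antipode k) (t * c ⊗ₜ d)) =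
          Ω (TensorProduct.assoc k A A A (t ⊗ₜ y)) := by
      induction t with
      | zero => simp
      | add x y hx hy => simp only [add_mul, mul_add, TensorProduct.add_tmul, map_add, hx, hy]
      | tmul x z => simp [Ω, mul_assoc, antipode_mul_antidistrib]
    have h2 (x y : A) : Ω (x ⊗ₜ Coalgebra.comul (R := k) y) =
        p (x * c) • Coalgebra.counit (R := k) y • antipode k (antipode k d) := by
      simpa [Ω, mul_antipode_left_apply] using smul_comm _ _ _
    have h3 := congrArg Ω (Coalgebra.coassoc_apply (R := k) h)
    conv at h3 => enter [1]; rw [← r.eq]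
    conv at h3 => enter [2]; rw [← r.eq]
    simp only [map_sum, LinearMap.rTensor_tmul, LinearMap.lTensor_tmul, h2] at h3
    simp only [h1, h3]
    have h4 := counit_right_apply (k := k) h
    rw [← r.eq] at h4
    simp only [map_sum, TensorProduct.map_tmul, TensorProduct.rid_tmul, LinearMap.id_apply] at h4
    conv_rhs => rw [← h4]
    simp [Finset.sum_mul, Finset.sum_smul, smul_smul, mul_comm]

lemma traceTwist_mulLeft [FiniteDimensional k A] (p : A →ₗ[k] k) (h : A) :
    traceTwist k A (p ∘ₗ LinearMap.mulLeft k h) = Coalgebra.counit (R := k) h * traceTwist k A p := by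
  let r := Coalgebra.Repr.arbitrary k h
  have h1 : twist (p ∘ₗ LinearMap.mulLeft k h) = ∑ i ∈ r.index,
      LinearMap.mulLeft k (antipode k (r.right i)) ∘ₗ twist p ∘ₗ LinearMap.mulLeft k (r.left i) := by
    ext a
    simpa [twist] using (sum_antipode_mul_comul_mul p h (Coalgebra.comul (R := k) a) r).symm
  have h2 := mul_antipode_right_apply (k := k) h
  rw [← r.eq] at h2
  simp only [map_sum, TensorProduct.map_tmul, LinearMap.id_apply, LinearMap.mul'_apply] at h2
  change LinearMap.trace k A _ = _ * LinearMap.trace k A _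
  calc LinearMap.trace k A (twist (p ∘ₗ LinearMap.mulLeft k h))
      = ∑ i ∈ r.index, LinearMap.trace k A
          (twist p ∘ₗ LinearMap.mulLeft k (r.left i * antipode k (r.right i))) := by
        rw [h1, map_sum]
        refine Finset.sum_congr rfl fun i _ => ?_
        rw [LinearMap.trace_comp_comm', LinearMap.comp_assoc, LinearMap.mulLeft_mul]
    _ = LinearMap.trace k A (twist p ∘ₗ LinearMap.mulLeft k
          (∑ i ∈ r.index, r.left i * antipode k (r.right i))) := by
        rw [← map_sum]
        congr 1
        ext a
        simp [Finset.sum_mul, mul_assoc]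
    _ = _ := by
        rw [h2, ← smul_eq_mul, ← map_smul]
        congr 1
        ext a
        simp

end Integral

section TwistNilpotent

open HopfAlgebra WithConv

variable {k} {A : Type v} [Ring A] [HopfAlgebra k A] [FiniteDimensional k A]

/-- A linear form vanishing on the grouplike elements of a pointed Hopf algebra lies in the
Jacobson radical of the dual algebra. -/
lemma toConv_mem_jacobson (hA : IsPointed k A) {p : A →ₗ[k] k}
    (hp : ∀ g, IsGroupLikeElem k g → p g = 0) :
    toConv p ∈ Ring.jacobson (WithConv (A →ₗ[k] k)) := by
  have : FiniteDimensional k (WithConv (A →ₗ[k] k)) :=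
    Module.Finite.equiv (WithConv.linearEquiv k (A →ₗ[k] k)).symm
  refine mem_jacobson_of_forall_algHom (k := k)
    (fun C _ _ _ φ hφ => finrank_eq_one_of_isPointedOf hA φ hφ) fun χ => ?_
  let g : A := (Module.evalEquiv k A).symm
    (χ.toLinearMap ∘ₗ (WithConv.linearEquiv k (A →ₗ[k] k)).symm.toLinearMap)
  have hg (q : A →ₗ[k] k) : q g = χ (toConv q) :=
    Module.apply_evalEquiv_symm_apply (R := k) (M := A) q _
  rw [← hg]
  refine hp g ⟨?_, ?_⟩
  · rw [hg, ← map_one χ]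
    congr 1
  · refine tensor_ext_dual fun q r => ?_
    rw [TensorProduct.map_tmul, LinearMap.mul'_apply, hg q, hg r, ← map_mul, ← ofConv_toConv (_ * _)]
    exact hg (toConv q * toConv r).ofConv

lemma antipode_antipode_pow_comul {A : Type*} [Ring A] [HopfAlgebra k A] (n : ℕ) (a : A) :
    Coalgebra.comul (R := k) (((antipode k ∘ₗ antipode k) ^ n : A →ₗ[k] A) a) =
      TensorProduct.map ((antipode k ∘ₗ antipode k) ^ n) ((antipode k ∘ₗ antipode k) ^ n)
        (Coalgebra.comul (R := k) a) := by
  induction n with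
  | zero => simp [Module.End.one_eq_id]
  | succ n ih =>
    rw [pow_succ', TensorProduct.map_mul, Module.End.mul_apply, Module.End.mul_apply, ← ih]
    exact antipode_antipode_comul _

lemma isNilpotent_twist (hA : IsPointed k A) {p : A →ₗ[k] k}
    (hp : ∀ g, IsGroupLikeElem k g → p g = 0) : IsNilpotent (twist p) := by
  have : FiniteDimensional k (WithConv (A →ₗ[k] k)) :=
    Module.Finite.equiv (WithConv.linearEquiv k (A →ₗ[k] k)).symm
  have : IsArtinianRing (WithConv (A →ₗ[k] k)) := .of_finite k _
  let J := Ring.jacobson (WithConv (A →ₗ[k] k))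
  let S2 : A →ₗ[k] A := antipode k ∘ₗ antipode k
  have hpn (n : ℕ) : toConv (p ∘ₗ S2 ^ n) ∈ J := by
    refine toConv_mem_jacobson hA fun g hg => ?_
    have : (S2 ^ n) g = g := by
      induction n with
      | zero => rfl
      | succ n ih => rw [pow_succ', Module.End.mul_apply, ih]; exact hg.antipode_antipode
    rw [LinearMap.comp_apply, this, hp g hg]
  have hstep (n : ℕ) (q : A →ₗ[k] k) : toConv ((q ∘ₗ twist p) ∘ₗ S2 ^ n) =
      toConv (p ∘ₗ S2 ^ n) * toConv (q ∘ₗ S2 ^ (n + 1)) := by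
    ext a
    rw [LinearMap.convMul_apply]
    simp only [LinearMap.comp_apply, twist, S2, LinearEquiv.coe_coe]
    rw [antipode_antipode_pow_comul, pow_succ']
    generalize Coalgebra.comul (R := k) a = t
    induction t with
    | zero => simp
    | add x y hx hy => simp only [map_add, hx, hy]
    | tmul x y => simp
  have key (n : ℕ) : ∃ y ∈ J ^ n, ∀ (q : A →ₗ[k] k) (a : A),
      q ((twist p ^ n) a) = (y * toConv (q ∘ₗ S2 ^ n)) a := by
    induction n with
    | zero => exact ⟨1, by rw [Submodule.pow_zero, Ideal.one_eq_top]; trivial,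
        fun q a => by simp [Module.End.one_eq_id]⟩
    | succ n ih =>
      obtain ⟨y, hy, h⟩ := ih
      refine ⟨y * toConv (p ∘ₗ S2 ^ n), ?_, fun q a => ?_⟩
      · rw [Submodule.pow_succ]
        exact Ideal.mul_mem_mul hy (hpn n)
      · rw [mul_assoc, ← hstep, ← h, pow_succ']
        rfl
  obtain ⟨n, hn⟩ := IsSemiprimaryRing.isNilpotent (R := WithConv (A →ₗ[k] k))
  obtain ⟨y, hy, h⟩ := key n
  obtain rfl : y = 0 := by
    have : y ∈ (0 : Ideal (WithConv (A →ₗ[k] k))) := hn ▸ hy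
    exact this
  refine ⟨n, ?_⟩
  ext a
  refine (Module.forall_dual_apply_eq_zero_iff k _).1 fun q => ?_
  rw [h, zero_mul]
  rfl

end TwistNilpotent

section Semisimple

open HopfAlgebra WithConv

variable {k} {A : Type v} [Ring A] [HopfAlgebra k A]

lemma exists_dual_groupLike (g₀ : GroupLike k A) :
    ∃ δ : A →ₗ[k] k, ∀ g : GroupLike k A, δ g.val = Finsupp.single g (1 : k) g₀ := by
  have hv := linearIndep_groupLikeVal (R := k) (A := A)
  obtain ⟨δ, hδ⟩ := (Finsupp.lapply g₀ ∘ₗ hv.repr).exists_extend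
  refine ⟨δ, fun g => ?_⟩
  have h := LinearMap.congr_fun hδ ⟨g.val, Submodule.subset_span ⟨g, rfl⟩⟩
  simp only [LinearMap.comp_apply, Submodule.subtype_apply] at h
  rw [h, hv.repr_eq_single g _ rfl]
  rfl

lemma sum_antipode_tmul_mul_comul (h : A) {ι : Type*} (r : Coalgebra.Repr k h ι) :
    ∑ i ∈ r.index, (antipode k (r.left i) ⊗ₜ[k] (1 : A)) * Coalgebra.comul (R := k) (r.right i) =
      1 ⊗ₜ h := by
  let Ω : A ⊗[k] (A ⊗[k] A) →ₗ[k] A ⊗[k] A :=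
    TensorProduct.map (LinearMap.mul' k A ∘ₗ TensorProduct.map (antipode k) LinearMap.id)
      LinearMap.id ∘ₗ (TensorProduct.assoc k A A A).symm.toLinearMap
  have h1 (x : A) (t : A ⊗[k] A) : (antipode k x ⊗ₜ[k] (1 : A)) * t = Ω (x ⊗ₜ t) := by
    induction t with
    | zero => simp
    | add y z hy hz => simp only [mul_add, TensorProduct.tmul_add, map_add, hy, hz]
    | tmul y z => simp [Ω]
  have h2 (x y : A) : Ω (TensorProduct.assoc k A A A (Coalgebra.comul (R := k) x ⊗ₜ y)) =
      1 ⊗ₜ (Coalgebra.counit (R := k) x • y) := by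
    simp [Ω, mul_antipode_left_apply, TensorProduct.smul_tmul]
  have h3 := congrArg Ω (Coalgebra.coassoc_apply (R := k) h)
  conv at h3 => enter [1]; rw [← r.eq]
  conv at h3 => enter [2]; rw [← r.eq]
  simp only [map_sum, LinearMap.rTensor_tmul, LinearMap.lTensor_tmul, h2] at h3
  have h4 := counit_left_apply (k := k) h
  rw [← r.eq] at h4
  simp only [map_sum, TensorProduct.map_tmul, TensorProduct.lid_tmul, LinearMap.id_apply] at h4
  simp only [h1]
  rw [← h3, ← TensorProduct.tmul_sum, h4]

/-- If the span of the grouplike elements contains a nonzero left integral, then it is everything. -/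
lemma span_groupLike_eq_top {Λ : A} (hΛ : ∀ h : A, h * Λ = Coalgebra.counit (R := k) h • Λ)
    (h0 : Λ ≠ 0) (hmem : Λ ∈ Submodule.span k (Set.range (GroupLike.val (R := k) (A := A)))) :
    Submodule.span k (Set.range (GroupLike.val (R := k) (A := A))) = ⊤ := by
  rw [eq_top_iff]
  intro h _
  set W := Submodule.span k (Set.range (GroupLike.val (R := k) (A := A)))
  have hcomul : ((1 : A) ⊗ₜ[k] h) * Coalgebra.comul (R := k) Λ =
      (antipode k h ⊗ₜ[k] (1 : A)) * Coalgebra.comul (R := k) Λ := by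
    let r := Coalgebra.Repr.arbitrary k h
    have h4 := counit_right_apply (k := k) h
    rw [← r.eq] at h4
    simp only [map_sum, TensorProduct.map_tmul, TensorProduct.rid_tmul, LinearMap.id_apply] at h4
    rw [← sum_antipode_tmul_mul_comul h r, Finset.sum_mul]
    conv_rhs => rw [← h4]
    simp only [map_sum, TensorProduct.sum_tmul, Finset.sum_mul, map_smul]
    refine Finset.sum_congr rfl fun i _ => ?_
    rw [mul_assoc, ← Bialgebra.comul_mul, hΛ, map_smul, mul_smul_comm, ← smul_mul_assoc,
      TensorProduct.smul_tmul']
  obtain ⟨c, rfl⟩ := (Finsupp.mem_span_range_iff_exists_finsupp).1 hmem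
  obtain ⟨g₀, hg₀⟩ : ∃ g₀, c g₀ ≠ 0 := by
    by_contra! hc
    obtain rfl : c = 0 := Finsupp.ext hc
    simp at h0
  obtain ⟨δ, hδ⟩ := exists_dual_groupLike g₀
  have h5 := congrArg (fun t => TensorProduct.lid k A (TensorProduct.map δ LinearMap.id t)) hcomul
  simp only [Finsupp.sum, map_sum, map_smul, GroupLike.isGroupLikeElem_val,
    IsGroupLikeElem.comul_eq_tmul_self, Finset.mul_sum, mul_smul_comm,
    Algebra.TensorProduct.tmul_mul_tmul, one_mul, TensorProduct.map_tmul, TensorProduct.lid_tmul,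
    hδ, LinearMap.id_apply] at h5
  rw [Finset.sum_eq_single g₀ (fun g _ hg => by simp [hg])
    (fun hg => by simp [Finsupp.notMem_support_iff.1 hg])] at h5
  have h6 : c g₀ • (h * g₀.val) ∈ W := by
    simp only [Finsupp.single_eq_same, one_smul] at h5
    rw [h5]
    exact Submodule.sum_mem _ fun g _ => W.smul_mem _ (W.smul_mem _ (Submodule.subset_span ⟨g, rfl⟩))
  have h7 : h * g₀.val ∈ W := (Submodule.smul_mem_iff _ hg₀).1 h6
  have h8 : ∀ x ∈ W, x * antipode k g₀.val ∈ W := by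
    intro x hx
    induction hx using Submodule.span_induction with
    | mem x hx =>
      obtain ⟨g, rfl⟩ := hx
      exact Submodule.subset_span ⟨g * g₀⁻¹, by simp⟩
    | zero => simp
    | add x y _ _ hx hy => rw [add_mul]; exact W.add_mem hx hy
    | smul a x _ hx => rw [smul_mul_assoc]; exact W.smul_mem _ hx
  simpa [mul_assoc, g₀.isGroupLikeElem_val] using h8 _ h7

/-- If `Tr(S²) ≠ 0` for a finite-dimensional pointed Hopf algebra, then it is spanned by its
grouplike elements. -/
lemma span_groupLike_eq_top_of_trace_ne_zero [FiniteDimensional k A] (hA : IsPointed k A)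
    (htr : LinearMap.trace k A (antipode k ∘ₗ antipode k) ≠ 0) :
    Submodule.span k (Set.range (GroupLike.val (R := k) (A := A))) = ⊤ := by
  let Λ : A := (Module.evalEquiv k A).symm (traceTwist k A)
  have hp (p : A →ₗ[k] k) : p Λ = traceTwist k A p :=
    Module.apply_evalEquiv_symm_apply (R := k) (M := A) p _
  refine span_groupLike_eq_top (Λ := Λ) (fun h => ?_) (fun h0 => htr ?_) ?_
  · rw [← sub_eq_zero]
    refine (Module.forall_dual_apply_eq_zero_iff k _).1 fun p => ?_
    have := hp (p ∘ₗ LinearMap.mulLeft k h)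
    rw [traceTwist_mulLeft, ← hp] at this
    simpa [sub_eq_zero] using this
  · rw [← twist_counit]
    exact (hp Coalgebra.counit).symm.trans (by rw [h0, map_zero])
  · rw [← Subspace.dualAnnihilator_dualCoannihilator_eq
      (W := Submodule.span k (Set.range (GroupLike.val (R := k) (A := A)))),
      Submodule.mem_dualCoannihilator]
    intro p hpW
    rw [hp]
    refine (LinearMap.isNilpotent_trace_of_isNilpotent (isNilpotent_twist hA fun g hg => ?_)).eq_zero
    exact (Submodule.mem_dualAnnihilator p).1 hpW g (Submodule.subset_span ⟨⟨g, hg⟩, rfl⟩)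

/-- A sub-Hopf-algebra of a Hopf algebra spanned by finitely many grouplike elements is
semisimple in characteristic zero. -/
lemma isSemisimpleRing_of_span_groupLike [CharZero k] [FiniteDimensional k A]
    (hspan : Submodule.span k (Set.range (GroupLike.val (R := k) (A := A))) = ⊤)
    {B : Subalgebra k A} (hB : IsSubHopf k A B) : IsSemisimpleRing B := by
  let H : Subgroup (GroupLike k A) :=
    { carrier := {g | g.val ∈ B}
      mul_mem' := fun ha hb => B.mul_mem ha hb
      one_mem' := B.one_mem
      inv_mem' := fun ha => hB.2 _ ha }
  have : Finite (GroupLike k A) := (linearIndep_groupLikeVal (R := k) (A := A)).finite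
  let φ : H →* B :=
    { toFun := fun g => ⟨g.1.val, g.2⟩
      map_one' := rfl
      map_mul' := fun _ _ => rfl }
  let f : MonoidAlgebra k H →ₐ[k] B := MonoidAlgebra.lift k B H φ
  have : NeZero (Nat.card H : k) := ⟨Nat.cast_ne_zero.2 Nat.card_pos.ne'⟩
  refine RingHom.isSemisimpleRing_of_surjective f.toRingHom ?_
  rintro ⟨x, hx⟩
  have hmem : x ∈ Submodule.span k (Set.range (GroupLike.val (R := k) (A := A))) :=
    hspan ▸ Submodule.mem_top
  obtain ⟨c, rfl⟩ := (Finsupp.mem_span_range_iff_exists_finsupp).1 hmem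
  have hc (g : GroupLike k A) : c g • g.val ∈ B := by
    obtain ⟨δ, hδ⟩ := exists_dual_groupLike g
    obtain ⟨t, ht⟩ := hB.1 _ hx
    have h1 : TensorProduct.lid k A (TensorProduct.map δ LinearMap.id
        (TensorProduct.map B.toSubmodule.subtype B.toSubmodule.subtype t)) ∈ B := by
      clear ht
      induction t with
      | zero => simp
      | add x y hx hy => simp only [map_add]; exact B.add_mem hx hy
      | tmul x y => simpa using B.smul_mem y.2 _
    rw [ht] at h1
    simp only [Finsupp.sum, map_sum, map_smul, GroupLike.isGroupLikeElem_val,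
      IsGroupLikeElem.comul_eq_tmul_self, TensorProduct.map_tmul, TensorProduct.lid_tmul,
      hδ, LinearMap.id_apply] at h1
    rw [Finset.sum_eq_single g (fun g' _ hg => by simp [hg])
      (fun hg => by simp [Finsupp.notMem_support_iff.1 hg])] at h1
    simpa using h1
  have hr (g : GroupLike k A) : (⟨c g • g.val, hc g⟩ : B) ∈ f.range := by
    by_cases h : c g = 0
    · convert f.range.zero_mem
      simp [h]
    · have hg : g ∈ H := by
        have := B.smul_mem (hc g) (c g)⁻¹
        rwa [smul_smul, inv_mul_cancel₀ h, one_smul] at this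
      refine ⟨c g • MonoidAlgebra.of k H ⟨g, hg⟩, ?_⟩
      change f _ = _
      rw [map_smul, MonoidAlgebra.lift_of]
      rfl
  have h2 := f.range.sum_mem (t := c.support) fun g _ => hr g
  rwa [show ∑ g ∈ c.support, (⟨c g • g.val, hc g⟩ : B) = ⟨_, hx⟩ from
    Subtype.ext (by simp [Finsupp.sum])] at h2

end Semisimple

/-- Let `(A,R)` be a finite-dimensional triangular pointed Hopf algebra
over a field `k` of characteristic `0` such that the minimal sub-Hopf-algebra `A_R`
corresponding to `R` is not semisimple. Then `dim(A)` is divisible by `4`. -/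
theorem dim_dvd_four_of_triangular_pointed_nonsemisimple
    (k : Type u) [Field k] [CharZero k]
    (A : Type v) [Ring A] [HopfAlgebra k A] [FiniteDimensional k A]
    (Q : QuasiTriangular k A) (htri : Q.IsTriangular) (hpointed : IsPointed k A)
    (hAR : ∃ B : Subalgebra k A, IsSubHopf k A B ∧ MemTensorSquare k A B.toSubmodule Q.R ∧
      (∀ B' : Subalgebra k A, IsSubHopf k A B' → MemTensorSquare k A B'.toSubmodule Q.R →
        B ≤ B') ∧
      ¬ IsSemisimpleRing B) :
    4 ∣ Module.finrank k A := by
  by_cases htr : LinearMap.trace k A (HopfAlgebra.antipode k ∘ₗ HopfAlgebra.antipode k) = 0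
  · exact four_dvd_finrank htri.isGroupLikeElem_drinfeld (htri.drinfeld_mul_self hpointed)
      Q.drinfeld_mul htr
  · obtain ⟨B, hB, -, -, hss⟩ := hAR
    exact (hss (isSemisimpleRing_of_span_groupLike
      (span_groupLike_eq_top_of_trace_ne_zero hpointed htr) hB)).elim

end Paper
end
end

section
/- Let (A,R) be a finite-dimensional quasitriangular Hopf algebra with antipode S over a field k of characteristic 0, and suppose that the Drinfeld element u of A acts as a scalar in every irreducible representation of A. Then u = S(u), and in particular S⁴ = I. -/
open TensorProduct

noncomputable section

universe u v w

namespace Paper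

variable (k : Type*) [Field k]

section Antipode

variable {k} {A : Type*} [Ring A] [HopfAlgebra k A]

open Coalgebra HopfAlgebra

local notation "S" => antipode k (A := A)
local notation "Δ" => comul (R := k) (A := A)
local notation "μ" => LinearMap.mul' k A

lemma antipode_mul_comul (a : A) :
    μ (TensorProduct.map S LinearMap.id (Δ a)) = algebraMap k A (counit a) :=
  mul_antipode_rTensor_comul_apply a

lemma mul_antipode_comul (a : A) :
    μ (TensorProduct.map LinearMap.id S (Δ a)) = algebraMap k A (counit a) :=
  mul_antipode_lTensor_comul_apply a

lemma map_antipode_antipode_mul (s t : A ⊗[k] A) :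
    TensorProduct.map S S (s * t) = TensorProduct.map S S t * TensorProduct.map S S s := by
  induction s with
  | zero => simp
  | add x y hx hy => simp [add_mul, mul_add, hx, hy]
  | tmul a b =>
    induction t with
    | zero => simp
    | add x y hx hy => simp [add_mul, mul_add, hx, hy]
    | tmul c d => simp [antipode_mul_antidistrib]

/-- `Σ S(y₁) y₂ ⊗ y₃ = 1 ⊗ y`. -/
lemma map_antipode_one_mul_comul (y : A) :
    LinearMap.mul' k (A ⊗[k] A) (TensorProduct.map
      ((TensorProduct.mk k A A).flip 1 ∘ₗ S) Δ (Δ y)) = 1 ⊗ₜ y := by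
  have h : ∀ t : A ⊗[k] A, LinearMap.mul' k (A ⊗[k] A) (TensorProduct.map
      ((TensorProduct.mk k A A).flip 1 ∘ₗ S) Δ t) =
      TensorProduct.map (μ ∘ₗ TensorProduct.map S LinearMap.id) LinearMap.id
        ((TensorProduct.assoc k A A A).symm (TensorProduct.map LinearMap.id Δ t)) := by
    intro t
    induction t with
    | zero => simp
    | add x y hx hy => simp [hx, hy]
    | tmul b c =>
      simp only [TensorProduct.map_tmul, LinearMap.mul'_apply, LinearMap.comp_apply,
        LinearMap.flip_apply, TensorProduct.mk_apply, LinearMap.id_apply]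
      generalize Δ c = s
      induction s with
      | zero => simp
      | add x y hx hy => simp [hx, hy, mul_add, TensorProduct.tmul_add]
      | tmul c d => simp
  have h' : ∀ t : A ⊗[k] A,
      TensorProduct.map (μ ∘ₗ TensorProduct.map S LinearMap.id) LinearMap.id
        (TensorProduct.map Δ LinearMap.id t) =
      1 ⊗ₜ TensorProduct.lid k A (TensorProduct.map counit LinearMap.id t) := by
    intro t
    induction t with
    | zero => simp
    | add x y hx hy => simp [hx, hy, TensorProduct.tmul_add]
    | tmul b c =>
      simp [antipode_mul_comul, Algebra.algebraMap_eq_smul_one, TensorProduct.smul_tmul]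
  rw [h]
  have := coassoc_symm_apply (R := k) y
  simp only [LinearMap.lTensor, LinearMap.rTensor] at this
  rw [this, h']
  have := rTensor_counit_comul (R := k) y
  simp only [LinearMap.rTensor] at this
  rw [this]
  simp

/-- The antipode is an anti-coalgebra map. -/
lemma comul_antipode_s4 (x : A) :
    Δ (S x) = TensorProduct.map S S (TensorProduct.comm k A A (Δ x)) := by
  let F : A →ₗ[k] A ⊗[k] A := Δ ∘ₗ S
  let G : A →ₗ[k] A ⊗[k] A :=
    TensorProduct.map S S ∘ₗ (TensorProduct.comm k A A).toLinearMap ∘ₗ Δ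
  suffices h : WithConv.toConv G = WithConv.toConv F from
    (LinearMap.congr_fun (WithConv.toConv_injective h) x).symm
  refine left_inv_eq_right_inv (a := WithConv.toConv Δ) ?_ LinearMap.comul_right_inv
  ext x
  have h : ∀ t : A ⊗[k] A, LinearMap.mul' k (A ⊗[k] A) (TensorProduct.map G Δ t) =
      LinearMap.mul' k (A ⊗[k] A) (TensorProduct.map (TensorProduct.mk k A A 1 ∘ₗ S)
        (LinearMap.mul' k (A ⊗[k] A) ∘ₗ
          TensorProduct.map ((TensorProduct.mk k A A).flip 1 ∘ₗ S) Δ)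
        (TensorProduct.assoc k A A A (TensorProduct.map Δ LinearMap.id t))) := by
    intro t
    induction t with
    | zero => simp
    | add x y hx hy => simp [hx, hy]
    | tmul b c =>
      simp only [TensorProduct.map_tmul, LinearMap.mul'_apply, LinearMap.comp_apply,
        LinearMap.id_apply, G, LinearEquiv.coe_coe]
      generalize Δ b = s
      induction s with
      | zero => simp
      | add x y hx hy => simp [hx, hy, add_mul, TensorProduct.add_tmul]
      | tmul a b => simp [← mul_assoc]
  have h' : ∀ t : A ⊗[k] A,
      LinearMap.mul' k (A ⊗[k] A) (TensorProduct.map (TensorProduct.mk k A A 1 ∘ₗ S)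
        (LinearMap.mul' k (A ⊗[k] A) ∘ₗ
          TensorProduct.map ((TensorProduct.mk k A A).flip 1 ∘ₗ S) Δ)
        (TensorProduct.map LinearMap.id Δ t)) =
      1 ⊗ₜ μ (TensorProduct.map S LinearMap.id t) := by
    intro t
    induction t with
    | zero => simp
    | add x y hx hy => simp [hx, hy, TensorProduct.tmul_add]
    | tmul b c => simp [map_antipode_one_mul_comul]
  have := coassoc_apply (R := k) x
  simp only [LinearMap.lTensor, LinearMap.rTensor] at this
  rw [LinearMap.convMul_apply]
  dsimp only
  rw [h, this, h', antipode_mul_comul, LinearMap.convOne_apply]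
  simp [Algebra.algebraMap_eq_smul_one, Algebra.TensorProduct.one_def]

end Antipode

section RMatrix

variable {k} {A : Type*} [Ring A] [HopfAlgebra k A]

open Coalgebra HopfAlgebra

local notation "ι₁" => Algebra.TensorProduct.includeLeft (R := k) (S := k) (A := A) (B := A)
local notation "ι₂" => Algebra.TensorProduct.includeRight (R := k) (A := A) (B := A)
local notation "S" => antipode k (A := A)
local notation "Δ" => comul (R := k) (A := A)
local notation "μ" => LinearMap.mul' k A
local notation "ηε" => Algebra.linearMap k A ∘ₗ counit (R := k) (A := A)

namespace QuasiTriangular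

variable (Q : QuasiTriangular k A)

/-- The first hexagon identity, with linear maps `f` and `g` applied to the first two legs,
which are then multiplied. -/
lemma map_convolution_id (f g : A →ₗ[k] A) :
    TensorProduct.map (μ ∘ₗ TensorProduct.map f g ∘ₗ Δ) LinearMap.id Q.R =
      TensorProduct.map f LinearMap.id Q.R * TensorProduct.map g LinearMap.id Q.R := by
  have hl : ∀ t : A ⊗[k] A, TensorProduct.map (μ ∘ₗ TensorProduct.map f g ∘ₗ Δ) LinearMap.id t =
      TensorProduct.map (μ ∘ₗ TensorProduct.map f g) LinearMap.id
        (Algebra.TensorProduct.map (Bialgebra.comulAlgHom k A) (AlgHom.id k A) t) := by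
    intro t
    induction t with
    | zero => simp
    | add x y hx hy => simp only [map_add, hx, hy]
    | tmul a b => simp
  have hr : ∀ s t : A ⊗[k] A, TensorProduct.map (μ ∘ₗ TensorProduct.map f g) LinearMap.id
      (Algebra.TensorProduct.map ι₁ (AlgHom.id k A) s *
        Algebra.TensorProduct.map ι₂ (AlgHom.id k A) t) =
      TensorProduct.map f LinearMap.id s * TensorProduct.map g LinearMap.id t := by
    intro s t
    induction s with
    | zero => simp
    | add x y hx hy => simp only [map_add, add_mul, hx, hy]
    | tmul a b =>
      induction t with
      | zero => simp
      | add x y hx hy => simp only [map_add, mul_add, hx, hy]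
      | tmul c d => simp
  rw [hl, Q.hexagon₁, hr]

/-- `(ε ⊗ id)(R) = 1`. -/
lemma map_counit_id : TensorProduct.map ηε LinearMap.id Q.R = 1 := by
  have h := Q.map_convolution_id ηε LinearMap.id
  have e : μ ∘ₗ TensorProduct.map ηε LinearMap.id ∘ₗ Δ = LinearMap.id :=
    congr_arg WithConv.ofConv (one_mul (WithConv.toConv (LinearMap.id : A →ₗ[k] A)))
  rw [e, TensorProduct.map_id, LinearMap.id_apply] at h
  exact Q.isUnit.mul_right_cancel (h.symm.trans (one_mul _).symm)

/-- `(S ⊗ id)(R)` is a left inverse of `R`. -/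
lemma map_antipode_mul : TensorProduct.map S LinearMap.id Q.R * Q.R = 1 := by
  have h := Q.map_convolution_id S LinearMap.id
  have e : μ ∘ₗ TensorProduct.map S LinearMap.id ∘ₗ Δ = ηε :=
    LinearMap.ext antipode_mul_comul
  rw [e, map_counit_id, TensorProduct.map_id, LinearMap.id_apply] at h
  exact h.symm

/-- `(S ⊗ id)(R)` is a right inverse of `R`. -/
lemma mul_map_antipode : Q.R * TensorProduct.map S LinearMap.id Q.R = 1 := by
  have h := Q.map_convolution_id LinearMap.id S
  have e : μ ∘ₗ TensorProduct.map LinearMap.id S ∘ₗ Δ = ηε :=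
    LinearMap.ext mul_antipode_comul
  rw [e, map_counit_id, TensorProduct.map_id, LinearMap.id_apply] at h
  exact h.symm

/-- The second hexagon identity, with linear maps `f` and `g` applied to the last two legs,
which are then multiplied. -/
lemma map_id_convolution (f g : A →ₗ[k] A) :
    TensorProduct.map LinearMap.id (μ ∘ₗ TensorProduct.map f g ∘ₗ Δ) Q.R =
      TensorProduct.map LinearMap.id (μ ∘ₗ TensorProduct.map f g)
        (Algebra.TensorProduct.map (AlgHom.id k A) ι₂ Q.R *
          Algebra.TensorProduct.map (AlgHom.id k A) ι₁ Q.R) := by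
  have hl : ∀ t : A ⊗[k] A, TensorProduct.map LinearMap.id (μ ∘ₗ TensorProduct.map f g ∘ₗ Δ) t =
      TensorProduct.map LinearMap.id (μ ∘ₗ TensorProduct.map f g)
        (Algebra.TensorProduct.map (AlgHom.id k A) (Bialgebra.comulAlgHom k A) t) := by
    intro t
    induction t with
    | zero => simp
    | add x y hx hy => simp only [map_add, hx, hy]
    | tmul a b => simp
  rw [hl, Q.hexagon₂]

/-- `(id ⊗ ε)(R) = 1`. -/
lemma map_id_counit : TensorProduct.map LinearMap.id ηε Q.R = 1 := by
  have h := Q.map_id_convolution LinearMap.id ηε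
  have e : μ ∘ₗ TensorProduct.map LinearMap.id ηε ∘ₗ Δ = LinearMap.id :=
    congr_arg WithConv.ofConv (mul_one (WithConv.toConv (LinearMap.id : A →ₗ[k] A)))
  have hr : ∀ s t : A ⊗[k] A,
      TensorProduct.map LinearMap.id (μ ∘ₗ TensorProduct.map LinearMap.id ηε)
        (Algebra.TensorProduct.map (AlgHom.id k A) ι₂ s *
          Algebra.TensorProduct.map (AlgHom.id k A) ι₁ t) =
      TensorProduct.map LinearMap.id ηε s * t := by
    intro s t
    induction s with
    | zero => simp
    | add x y hx hy => simp only [map_add, add_mul, hx, hy]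
    | tmul a b =>
      induction t with
      | zero => simp
      | add x y hx hy => simp only [map_add, mul_add, hx, hy]
      | tmul c d => simp [Algebra.algebraMap_eq_smul_one]
  rw [e, hr, TensorProduct.map_id, LinearMap.id_apply] at h
  exact Q.isUnit.mul_right_cancel (h.symm.trans (one_mul _).symm)

/-- `Σ aᵢ aⱼ ⊗ S(bⱼ) bᵢ = 1` where `R = Σ aᵢ ⊗ bᵢ`. -/
lemma map_antipode_mul_hexagon :
    TensorProduct.map LinearMap.id (μ ∘ₗ TensorProduct.map S LinearMap.id)
      (Algebra.TensorProduct.map (AlgHom.id k A) ι₂ Q.R *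
        Algebra.TensorProduct.map (AlgHom.id k A) ι₁ Q.R) = 1 := by
  have h := Q.map_id_convolution S LinearMap.id
  have e : μ ∘ₗ TensorProduct.map S LinearMap.id ∘ₗ Δ = ηε :=
    LinearMap.ext antipode_mul_comul
  rw [← h, e, map_id_counit]

/-- `(S ⊗ S)(R) = R`. -/
lemma map_antipode_antipode : TensorProduct.map S S Q.R = Q.R := by
  have hr : ∀ s t : A ⊗[k] A, TensorProduct.map S LinearMap.id
      (TensorProduct.map LinearMap.id (μ ∘ₗ TensorProduct.map S LinearMap.id)
        (Algebra.TensorProduct.map (AlgHom.id k A) ι₂ s *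
          Algebra.TensorProduct.map (AlgHom.id k A) ι₁ t)) =
      TensorProduct.map S S t * TensorProduct.map S LinearMap.id s := by
    intro s t
    induction s with
    | zero => simp
    | add x y hx hy => simp only [map_add, add_mul, mul_add, hx, hy]
    | tmul a b =>
      induction t with
      | zero => simp
      | add x y hx hy => simp only [map_add, mul_add, add_mul, hx, hy]
      | tmul c d => simp [antipode_mul_antidistrib]
  have h := hr Q.R Q.R
  rw [map_antipode_mul_hexagon] at h
  refine left_inv_eq_right_inv (a := TensorProduct.map S LinearMap.id Q.R) ?_ Q.map_antipode_mul
  rw [← h]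
  simp [Algebra.TensorProduct.one_def]

lemma drinfeldOf_tmul (a b : A) : drinfeldOf k A (a ⊗ₜ b) = S b * a := by
  simp [drinfeldOf]

lemma drinfeldOf_add (s t : A ⊗[k] A) :
    drinfeldOf k A (s + t) = drinfeldOf k A s + drinfeldOf k A t := by
  simp [drinfeldOf]

lemma drinfeldOf_zero : drinfeldOf k A (0 : A ⊗[k] A) = 0 := by
  simp [drinfeldOf]

lemma drinfeldOf_mul (s t : A ⊗[k] A) :
    drinfeldOf k A (s * t) =
      μ (TensorProduct.map S (LinearMap.mulLeft k (drinfeldOf k A s))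
        (TensorProduct.comm k A A t)) := by
  induction t with
  | zero => simp [drinfeldOf_zero]
  | add y z hy hz => simp only [map_add, mul_add, drinfeldOf_add, hy, hz]
  | tmul a b =>
    induction s with
    | zero => simp [drinfeldOf_zero]
    | add s t hs ht =>
      simp only [add_mul, mul_add, drinfeldOf_add, hs, ht,
        TensorProduct.comm_tmul, TensorProduct.map_tmul,
        LinearMap.mulLeft_apply, LinearMap.mul'_apply]
    | tmul p q => simp [drinfeldOf_tmul, antipode_mul_antidistrib, mul_assoc]

/-- `S(u) = Σ a S(b)` where `R = Σ a ⊗ b`. -/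
lemma antipode_drinfeld :
    S Q.drinfeld = μ (TensorProduct.map LinearMap.id S Q.R) := by
  have h : ∀ t : A ⊗[k] A, S (drinfeldOf k A t) =
      μ (TensorProduct.map LinearMap.id S (TensorProduct.map S S t)) := by
    intro t
    induction t with
    | zero => simp [drinfeldOf_zero]
    | add x y hx hy => simp only [drinfeldOf_add, map_add, hx, hy]
    | tmul a b => simp [drinfeldOf_tmul, antipode_mul_antidistrib]
  rw [drinfeld, h, map_antipode_antipode]

/-- `S²(x) u = u x`. -/
lemma antipode_antipode_mul_drinfeld (x : A) :
    S (S x) * Q.drinfeld = Q.drinfeld * x := by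
  have hl : ∀ s y : A ⊗[k] A, drinfeldOf k A (TensorProduct.comm k A A y * s) =
      (μ ∘ₗ TensorProduct.map S (LinearMap.mulLeft k (μ (TensorProduct.map S LinearMap.id y))) ∘ₗ
        (TensorProduct.comm k A A).toLinearMap) s := by
    intro s y
    induction s with
    | zero => simp [drinfeldOf_zero]
    | add s t hs ht => simp only [map_add, mul_add, drinfeldOf_add, hs, ht]
    | tmul p q =>
      induction y with
      | zero => simp [drinfeldOf_zero]
      | add y z hy hz =>
        simp only [map_add, add_mul, mul_add, drinfeldOf_add, hy, hz, LinearMap.comp_apply,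
          LinearEquiv.coe_coe, TensorProduct.comm_tmul, TensorProduct.map_tmul,
          LinearMap.mulLeft_apply, LinearMap.mul'_apply]
      | tmul a b => simp [drinfeldOf_tmul, antipode_mul_antidistrib, mul_assoc]
  have hl' : ∀ a : A, drinfeldOf k A (TensorProduct.comm k A A (Δ a) * Q.R) =
      counit (R := k) a • Q.drinfeld := by
    intro a
    rw [hl, antipode_mul_comul, drinfeld]
    generalize Q.R = s
    induction s with
    | zero => simp [drinfeldOf_zero]
    | add s t hs ht => simp only [map_add, drinfeldOf_add, hs, ht, smul_add]
    | tmul p q => simp [drinfeldOf_tmul, Algebra.algebraMap_eq_smul_one]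
  have hc : ∀ z : (A ⊗[k] A) ⊗[k] A,
      μ (TensorProduct.map (S ∘ₗ S) (μ ∘ₗ TensorProduct.map S (LinearMap.mulLeft k Q.drinfeld) ∘ₗ
        (TensorProduct.comm k A A).toLinearMap) (TensorProduct.comm k (A ⊗[k] A) A z)) =
      μ (TensorProduct.map (S ∘ₗ μ ∘ₗ TensorProduct.map LinearMap.id S)
        (LinearMap.mulLeft k Q.drinfeld)
        (TensorProduct.comm k A (A ⊗[k] A) (TensorProduct.assoc k A A A z))) := by
    intro z
    induction z with
    | zero => simp
    | add y z hy hz => simp only [map_add, hy, hz]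
    | tmul z c =>
      induction z with
      | zero => simp
      | add y z hy hz => simp only [map_add, TensorProduct.add_tmul, hy, hz]
      | tmul a b => simp [antipode_mul_antidistrib, mul_assoc]
  have h₁ : ∀ t : A ⊗[k] A,
      μ (TensorProduct.map (S ∘ₗ S) (μ ∘ₗ TensorProduct.map S (LinearMap.mulLeft k Q.drinfeld) ∘ₗ
        (TensorProduct.comm k A A).toLinearMap)
          (TensorProduct.comm k (A ⊗[k] A) A (TensorProduct.map Δ LinearMap.id t))) =
      S (S (TensorProduct.lid k A (TensorProduct.map counit LinearMap.id t))) * Q.drinfeld := by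
    intro t
    induction t with
    | zero => simp
    | add y z hy hz => simp only [map_add, add_mul, hy, hz]
    | tmul a b =>
      have e := hl' a
      rw [Q.intertwine, drinfeldOf_mul] at e
      simp only [TensorProduct.map_tmul, TensorProduct.comm_tmul, LinearMap.mul'_apply,
        LinearMap.comp_apply, LinearEquiv.coe_coe]
      rw [drinfeld, e]
      simp [drinfeld]
  have h₂ : ∀ t : A ⊗[k] A,
      μ (TensorProduct.map (S ∘ₗ μ ∘ₗ TensorProduct.map LinearMap.id S)
        (LinearMap.mulLeft k Q.drinfeld)
        (TensorProduct.comm k A (A ⊗[k] A) (TensorProduct.map LinearMap.id Δ t))) =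
      Q.drinfeld * TensorProduct.rid k A (TensorProduct.map LinearMap.id counit t) := by
    intro t
    induction t with
    | zero => simp
    | add y z hy hz => simp only [map_add, mul_add, hy, hz]
    | tmul a b => simp [mul_antipode_comul, Algebra.algebraMap_eq_smul_one]
  have e₁ := h₁ (Δ x)
  have e₂ := h₂ (Δ x)
  have c := coassoc_apply (R := k) x
  have c₁ := rTensor_counit_comul (R := k) x
  have c₂ := lTensor_counit_comul (R := k) x
  simp only [LinearMap.lTensor, LinearMap.rTensor] at c c₁ c₂
  rw [hc, c, e₂, c₁, c₂] at e₁
  simpa using e₁.symm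

/-- The Drinfeld element has a right inverse. -/
lemma exists_drinfeld_mul_eq_one : ∃ v, Q.drinfeld * v = 1 := by
  have h₁ : ∀ t : A ⊗[k] A,
      Q.drinfeld * μ (TensorProduct.comm k A A (TensorProduct.map (S ∘ₗ S) LinearMap.id t)) =
      μ (TensorProduct.map S (LinearMap.mulLeft k Q.drinfeld) (TensorProduct.comm k A A
        (TensorProduct.map S LinearMap.id (TensorProduct.map S S t)))) := by
    intro t
    induction t with
    | zero => simp
    | add y z hy hz => simp only [map_add, mul_add, hy, hz]
    | tmul a b => simp [← mul_assoc, antipode_antipode_mul_drinfeld]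
  refine ⟨_, (h₁ Q.R).trans ?_⟩
  rw [map_antipode_antipode, drinfeld, ← drinfeldOf_mul, mul_map_antipode,
    Algebra.TensorProduct.one_def, drinfeldOf_tmul]
  simp

/-- The right action of `(A ⊗ A) ⊗ (A ⊗ A)` on `A ⊗ A` given by
`x · (y ⊗ z) = (S ⊗ S)(z) x y`. -/
def sandwich (x : A ⊗[k] A) : (A ⊗[k] A) ⊗[k] (A ⊗[k] A) →ₗ[k] A ⊗[k] A :=
  LinearMap.mul' k (A ⊗[k] A) ∘ₗ
    TensorProduct.map (TensorProduct.map S S) (LinearMap.mulLeft k x) ∘ₗ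
      (TensorProduct.comm k (A ⊗[k] A) (A ⊗[k] A)).toLinearMap

lemma sandwich_tmul (x y z : A ⊗[k] A) :
    sandwich x (y ⊗ₜ z) = TensorProduct.map S S z * (x * y) := by
  simp [sandwich]

lemma sandwich_zero (p : (A ⊗[k] A) ⊗[k] (A ⊗[k] A)) : sandwich 0 p = 0 := by
  induction p with
  | zero => simp
  | add p q hp hq => simp [hp, hq]
  | tmul y z => simp [sandwich_tmul]

lemma sandwich_add (x y : A ⊗[k] A) (p : (A ⊗[k] A) ⊗[k] (A ⊗[k] A)) :
    sandwich (x + y) p = sandwich x p + sandwich y p := by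
  induction p with
  | zero => simp
  | add p q hp hq => rw [map_add, hp, hq, map_add, map_add]; abel
  | tmul y z => simp [sandwich_tmul, add_mul, mul_add]

lemma sandwich_mul (x : A ⊗[k] A) (p q : (A ⊗[k] A) ⊗[k] (A ⊗[k] A)) :
    sandwich x (p * q) = sandwich (sandwich x p) q := by
  induction p with
  | zero => simp [sandwich_zero]
  | add p p' hp hp' => rw [add_mul, map_add, hp, hp', map_add, sandwich_add]
  | tmul y z =>
    induction q with
    | zero => simp
    | add q q' hq hq' => rw [mul_add, map_add, hq, hq', map_add]
    | tmul y' z' =>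
      simp [sandwich_tmul, map_antipode_antipode_mul, mul_assoc]

local notation "R₁₃" => Algebra.TensorProduct.map ι₁ ι₁
local notation "R₁₄" => Algebra.TensorProduct.map ι₁ ι₂
local notation "R₂₃" => Algebra.TensorProduct.map ι₂ ι₁
local notation "R₂₄" => Algebra.TensorProduct.map ι₂ ι₂

local notation "Δᵒᵖ" => AlgHom.comp (AlgEquiv.toAlgHom (Algebra.TensorProduct.comm k A A)) (Bialgebra.comulAlgHom k A)

/-- `(Δᵒᵖ ⊗ id)(t) R₁₂ = R₁₂ (Δ ⊗ id)(t)`. -/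
lemma map_comulOp_mul (t : A ⊗[k] A) :
    Algebra.TensorProduct.map Δᵒᵖ (AlgHom.id k A) t * (Q.R ⊗ₜ 1) =
      (Q.R ⊗ₜ 1) * Algebra.TensorProduct.map (Bialgebra.comulAlgHom k A) (AlgHom.id k A) t := by
  induction t with
  | zero => simp
  | add x y hx hy => simp only [map_add, add_mul, mul_add, hx, hy]
  | tmul a b =>
    have : Algebra.TensorProduct.comm k A A (Δ a) * Q.R = Q.R * Δ a := Q.intertwine a
    simp [this]

/-- The quantum Yang–Baxter equation `R₁₂ R₁₃ R₂₃ = R₂₃ R₁₃ R₁₂`. -/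
lemma yangBaxter :
    (Q.R ⊗ₜ 1) * (Algebra.TensorProduct.map ι₁ (AlgHom.id k A) Q.R *
        Algebra.TensorProduct.map ι₂ (AlgHom.id k A) Q.R) =
      Algebra.TensorProduct.map ι₂ (AlgHom.id k A) Q.R *
        Algebra.TensorProduct.map ι₁ (AlgHom.id k A) Q.R * (Q.R ⊗ₜ 1) := by
  have h₁ : Algebra.TensorProduct.map Δᵒᵖ (AlgHom.id k A) =
      (Algebra.TensorProduct.map (Algebra.TensorProduct.comm k A A).toAlgHom
        (AlgHom.id k A)).comp
        (Algebra.TensorProduct.map (Bialgebra.comulAlgHom k A) (AlgHom.id k A)) := by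
    ext <;> simp
  have h₂ : (Algebra.TensorProduct.map (Algebra.TensorProduct.comm k A A).toAlgHom
      (AlgHom.id k A)).comp (Algebra.TensorProduct.map ι₁ (AlgHom.id k A)) =
      Algebra.TensorProduct.map ι₂ (AlgHom.id k A) := by
    ext <;> simp [Algebra.TensorProduct.one_def]
  have h₃ : (Algebra.TensorProduct.map (Algebra.TensorProduct.comm k A A).toAlgHom
      (AlgHom.id k A)).comp (Algebra.TensorProduct.map ι₂ (AlgHom.id k A)) =
      Algebra.TensorProduct.map ι₁ (AlgHom.id k A) := by
    ext <;> simp [Algebra.TensorProduct.one_def]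
  have h := Q.map_comulOp_mul Q.R
  rw [h₁, AlgHom.comp_apply, Q.hexagon₁, map_mul, ← AlgHom.comp_apply, ← AlgHom.comp_apply,
    h₂, h₃] at h
  exact h.symm

/-- `R₁₂ R₁ₙ R₂ₙ = R₂ₙ R₁ₙ R₁₂`, where `n` is the leg `3` or `4` selected by `f`. -/
lemma yangBaxter_map (f : A →ₐ[k] A ⊗[k] A) :
    (Q.R ⊗ₜ 1) * (Algebra.TensorProduct.map ι₁ f Q.R * Algebra.TensorProduct.map ι₂ f Q.R) =
      Algebra.TensorProduct.map ι₂ f Q.R * Algebra.TensorProduct.map ι₁ f Q.R * (Q.R ⊗ₜ 1) := by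
  have h := congr_arg (Algebra.TensorProduct.map (AlgHom.id k (A ⊗[k] A)) f) Q.yangBaxter
  have e : ∀ i : A →ₐ[k] A ⊗[k] A, (Algebra.TensorProduct.map (AlgHom.id k (A ⊗[k] A)) f).comp
      (Algebra.TensorProduct.map i (AlgHom.id k A)) = Algebra.TensorProduct.map i f := by
    intro i
    rw [← Algebra.TensorProduct.map_comp, AlgHom.id_comp, AlgHom.comp_id]
  simpa only [map_mul, ← AlgHom.comp_apply, e, Algebra.TensorProduct.map_tmul, AlgHom.id_apply,
    map_one] using h

lemma map_commute (s t : A ⊗[k] A) : R₁₄ s * R₂₃ t = R₂₃ t * R₁₄ s := by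
  induction s with
  | zero => simp
  | add x y hx hy => simp only [map_add, add_mul, mul_add, hx, hy]
  | tmul a b =>
    induction t with
    | zero => simp
    | add x y hx hy => simp only [map_add, add_mul, mul_add, hx, hy]
    | tmul c d => simp

/-- `(Δ ⊗ Δᵒᵖ)(R) = R₁₃ R₁₄ R₂₃ R₂₄`. -/
lemma map_comul_comulOp :
    Algebra.TensorProduct.map (Bialgebra.comulAlgHom k A) Δᵒᵖ Q.R =
      R₁₃ Q.R * R₁₄ Q.R * (R₂₃ Q.R * R₂₄ Q.R) := by
  have e₁ : Algebra.TensorProduct.map (Bialgebra.comulAlgHom k A) Δᵒᵖ =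
      (Algebra.TensorProduct.map (AlgHom.id k (A ⊗[k] A)) Δᵒᵖ).comp
        (Algebra.TensorProduct.map (Bialgebra.comulAlgHom k A) (AlgHom.id k A)) := by
    rw [← Algebra.TensorProduct.map_comp, AlgHom.id_comp, AlgHom.comp_id]
  have e₂ : ∀ i : A →ₐ[k] A ⊗[k] A,
      (Algebra.TensorProduct.map (AlgHom.id k (A ⊗[k] A)) Δᵒᵖ).comp
        (Algebra.TensorProduct.map i (AlgHom.id k A)) =
      (Algebra.TensorProduct.map i (Algebra.TensorProduct.comm k A A).toAlgHom).comp
        (Algebra.TensorProduct.map (AlgHom.id k A) (Bialgebra.comulAlgHom k A)) := by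
    intro i
    rw [← Algebra.TensorProduct.map_comp, ← Algebra.TensorProduct.map_comp, AlgHom.id_comp,
      AlgHom.comp_id, AlgHom.comp_id]
  have e₃ : ∀ i : A →ₐ[k] A ⊗[k] A,
      (Algebra.TensorProduct.map i (Algebra.TensorProduct.comm k A A).toAlgHom).comp
        (Algebra.TensorProduct.map (AlgHom.id k A) ι₂) = Algebra.TensorProduct.map i ι₁ := by
    intro i
    rw [← Algebra.TensorProduct.map_comp, AlgHom.comp_id]
    congr 1
  have e₄ : ∀ i : A →ₐ[k] A ⊗[k] A,
      (Algebra.TensorProduct.map i (Algebra.TensorProduct.comm k A A).toAlgHom).comp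
        (Algebra.TensorProduct.map (AlgHom.id k A) ι₁) = Algebra.TensorProduct.map i ι₂ := by
    intro i
    rw [← Algebra.TensorProduct.map_comp, AlgHom.comp_id]
    congr 1
  rw [e₁, AlgHom.comp_apply, Q.hexagon₁, map_mul, ← AlgHom.comp_apply, ← AlgHom.comp_apply,
    e₂, e₂, AlgHom.comp_apply, AlgHom.comp_apply, Q.hexagon₂, map_mul, map_mul,
    ← AlgHom.comp_apply, ← AlgHom.comp_apply, ← AlgHom.comp_apply, ← AlgHom.comp_apply,
    e₃, e₃, e₄, e₄]

/-- `R₁₂ R₁₃ R₁₄ R₂₃ R₂₄ = R₂₃ R₁₃ R₂₄ R₁₄ R₁₂`. -/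
lemma mul_map_comul_comulOp :
    (Q.R ⊗ₜ 1) * Algebra.TensorProduct.map (Bialgebra.comulAlgHom k A) Δᵒᵖ Q.R =
      R₂₃ Q.R * R₁₃ Q.R * R₂₄ Q.R * R₁₄ Q.R * (Q.R ⊗ₜ 1) := by
  rw [map_comul_comulOp]
  calc (Q.R ⊗ₜ 1) * (R₁₃ Q.R * R₁₄ Q.R * (R₂₃ Q.R * R₂₄ Q.R))
      = (Q.R ⊗ₜ 1) * (R₁₃ Q.R * R₂₃ Q.R) * (R₁₄ Q.R * R₂₄ Q.R) := by
        rw [mul_assoc (R₁₃ Q.R), ← mul_assoc (R₁₄ Q.R), map_commute]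
        simp only [mul_assoc]
    _ = R₂₃ Q.R * R₁₃ Q.R * ((Q.R ⊗ₜ 1) * (R₁₄ Q.R * R₂₄ Q.R)) := by
        rw [yangBaxter_map]
        simp only [mul_assoc]
    _ = _ := by
        rw [yangBaxter_map]
        simp only [mul_assoc]

lemma sandwich_map₂₃ : sandwich (TensorProduct.comm k A A Q.R) (R₂₃ Q.R) = 1 := by
  have h : ∀ s t : A ⊗[k] A, sandwich (TensorProduct.comm k A A s) (R₂₃ t) =
      TensorProduct.comm k A A
        (TensorProduct.map LinearMap.id (μ ∘ₗ TensorProduct.map S LinearMap.id)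
          (Algebra.TensorProduct.map (AlgHom.id k A) ι₂ s *
            Algebra.TensorProduct.map (AlgHom.id k A) ι₁ t)) := by
    intro s t
    induction s with
    | zero => simp [sandwich_zero]
    | add x y hx hy => simp only [map_add, sandwich_add, add_mul, hx, hy]
    | tmul a b =>
      induction t with
      | zero => simp
      | add x y hx hy => simp only [map_add, mul_add, hx, hy]
      | tmul c d => simp [sandwich_tmul]
  rw [h, map_antipode_mul_hexagon]
  simp [Algebra.TensorProduct.one_def]

lemma sandwich_map₁₃ (t : A ⊗[k] A) : sandwich 1 (R₁₃ t) = drinfeldOf k A t ⊗ₜ 1 := by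
  induction t with
  | zero => simp [drinfeldOf_zero]
  | add x y hx hy => simp only [map_add, drinfeldOf_add, hx, hy, TensorProduct.add_tmul]
  | tmul a b => simp [sandwich_tmul, drinfeldOf_tmul]

lemma sandwich_map₂₄ (v : A) (t : A ⊗[k] A) :
    sandwich (v ⊗ₜ 1) (R₂₄ t) = v ⊗ₜ drinfeldOf k A t := by
  induction t with
  | zero => simp [drinfeldOf_zero]
  | add x y hx hy => simp only [map_add, drinfeldOf_add, hx, hy, TensorProduct.tmul_add]
  | tmul a b => simp [sandwich_tmul, drinfeldOf_tmul]

lemma sandwich_map₁₄ (t : A ⊗[k] A) :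
    sandwich (Q.drinfeld ⊗ₜ Q.drinfeld) (R₁₄ t) =
      TensorProduct.map S LinearMap.id (TensorProduct.map S S t) *
        (Q.drinfeld ⊗ₜ Q.drinfeld) := by
  induction t with
  | zero => simp
  | add x y hx hy => simp only [map_add, add_mul, hx, hy]
  | tmul a b => simp [sandwich_tmul, antipode_antipode_mul_drinfeld]

/-- `u ⊗ u` commutes with `R`. -/
lemma drinfeld_tmul_mul :
    (Q.drinfeld ⊗ₜ[k] Q.drinfeld) * Q.R = Q.R * (Q.drinfeld ⊗ₜ Q.drinfeld) := by
  have h : ∀ t : A ⊗[k] A, (Q.drinfeld ⊗ₜ[k] Q.drinfeld) * t =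
      TensorProduct.map S S (TensorProduct.map S S t) * (Q.drinfeld ⊗ₜ Q.drinfeld) := by
    intro t
    induction t with
    | zero => simp
    | add x y hx hy => simp only [map_add, add_mul, mul_add, hx, hy]
    | tmul a b => simp [antipode_antipode_mul_drinfeld]
  rw [h, map_antipode_antipode, map_antipode_antipode]

lemma comm_mul (s t : A ⊗[k] A) : TensorProduct.comm k A A (s * t) =
    TensorProduct.comm k A A s * TensorProduct.comm k A A t :=
  map_mul (Algebra.TensorProduct.comm k A A) s t

/-- `R₂₁ R` commutes with the image of the comultiplication. -/
lemma comul_mul_comm (x : A) :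
    Δ x * (TensorProduct.comm k A A Q.R * Q.R) = TensorProduct.comm k A A Q.R * Q.R * Δ x := by
  have h : Δ x * TensorProduct.comm k A A Q.R =
      TensorProduct.comm k A A Q.R * TensorProduct.comm k A A (Δ x) := by
    have := congr_arg (TensorProduct.comm k A A) (Q.intertwine x)
    rwa [comm_mul, comm_mul, TensorProduct.comm_comm] at this
  rw [← mul_assoc, h, mul_assoc, Q.intertwine, mul_assoc]

/-- `Δ(u) R₂₁ R = u ⊗ u`. -/
lemma comul_drinfeld_mul :
    Δ Q.drinfeld * (TensorProduct.comm k A A Q.R * Q.R) = Q.drinfeld ⊗ₜ Q.drinfeld := by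
  have h : ∀ t : A ⊗[k] A, Δ (drinfeldOf k A t) * (TensorProduct.comm k A A Q.R * Q.R) =
      sandwich (TensorProduct.comm k A A Q.R)
        ((Q.R ⊗ₜ 1) * Algebra.TensorProduct.map (Bialgebra.comulAlgHom k A) Δᵒᵖ t) := by
    intro t
    induction t with
    | zero => simp [drinfeldOf_zero]
    | add x y hx hy => simp only [drinfeldOf_add, map_add, add_mul, mul_add, hx, hy]
    | tmul a b =>
      rw [drinfeldOf_tmul, Bialgebra.comul_mul, mul_assoc, comul_mul_comm, comul_antipode_s4]
      simp [sandwich_tmul, mul_assoc, ← Algebra.TensorProduct.comm_toLinearEquiv]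
  conv_lhs => rw [drinfeld]
  rw [h, mul_map_comul_comulOp, sandwich_mul, sandwich_mul, sandwich_mul, sandwich_mul,
    sandwich_map₂₃, sandwich_map₁₃, sandwich_map₂₄, ← drinfeld, sandwich_map₁₄,
    map_antipode_antipode, sandwich_tmul]
  rw [mul_assoc, drinfeld_tmul_mul, ← mul_assoc (TensorProduct.map S LinearMap.id Q.R),
    map_antipode_mul]
  simp [Algebra.TensorProduct.one_def]

/-- `Δ(S(u)) R₂₁ R = S(u) ⊗ S(u)`. -/
lemma comul_antipode_drinfeld_mul :
    Δ (S Q.drinfeld) * (TensorProduct.comm k A A Q.R * Q.R) =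
      S Q.drinfeld ⊗ₜ S Q.drinfeld := by
  have hS : ∀ t : A ⊗[k] A, TensorProduct.map S S (TensorProduct.comm k A A t) =
      TensorProduct.comm k A A (TensorProduct.map S S t) := by
    intro t
    induction t with
    | zero => simp
    | add x y hx hy => simp only [map_add, hx, hy]
    | tmul a b => simp
  have h := congr_arg (fun t => TensorProduct.map S S (TensorProduct.comm k A A t))
    Q.comul_drinfeld_mul
  simp only [comm_mul, map_antipode_antipode_mul, TensorProduct.comm_tmul,
    TensorProduct.map_tmul] at h
  simp only [hS, map_antipode_antipode, TensorProduct.comm_comm] at h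
  rw [comul_mul_comm, comul_antipode_s4, hS, h]

end QuasiTriangular

end RMatrix

section Grouplike

variable {k} {A : Type*} [Ring A] [HopfAlgebra k A] [FiniteDimensional k A]

/-- In characteristic zero, a grouplike element of a finite-dimensional Hopf algebra has finite
order, so it is trivial as soon as it is unipotent. -/
lemma eq_one_of_isGroupLikeElem [CharZero k] {g : A} (hg : IsGroupLikeElem k g)
    (hn : IsNilpotent (g - 1)) : g = 1 := by
  have : Finite (GroupLike k A) := (linearIndep_groupLikeVal (R := k) (A := A)).finite
  obtain ⟨n, hn0, hgn⟩ := (isOfFinOrder_of_finite (⟨g, hg⟩ : GroupLike k A)).exists_pow_eq_one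
  have hgn' : g ^ n = 1 := congr_arg GroupLike.val hgn
  obtain ⟨m, hm⟩ := hn
  have h₁ : minpoly k g ∣ Polynomial.X ^ n - Polynomial.C 1 := minpoly.dvd _ _ (by simp [hgn'])
  have h₂ : minpoly k g ∣ (Polynomial.X - Polynomial.C 1) ^ m := minpoly.dvd _ _ (by simp [hm])
  have hs : Squarefree (minpoly k g) :=
    (Polynomial.separable_X_pow_sub_C (1 : k) (by exact_mod_cast hn0.ne')
      one_ne_zero).squarefree.squarefree_of_dvd h₁
  obtain ⟨q, hq⟩ := hs.isRadical m _ h₂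
  simpa [sub_eq_zero] using congr_arg (Polynomial.aeval g) hq

end Grouplike

namespace QuasiTriangular

section Simple

variable {k} {A : Type*} [Ring A] [HopfAlgebra k A] (Q : QuasiTriangular k A)

open HopfAlgebra

local notation "S" => antipode k (A := A)

lemma isUnit_drinfeld [FiniteDimensional k A] : IsUnit Q.drinfeld := by
  have : IsArtinianRing A := IsArtinianRing.of_finite k A
  obtain ⟨v, hv⟩ := Q.exists_drinfeld_mul_eq_one
  exact IsUnit.of_mul_eq_one v hv

lemma isUnit_antipode_drinfeld [FiniteDimensional k A] : IsUnit (S Q.drinfeld) := by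
  obtain ⟨v, hv⟩ := Q.isUnit_drinfeld.exists_left_inv
  have : IsArtinianRing A := IsArtinianRing.of_finite k A
  refine IsUnit.of_mul_eq_one (S v) ?_
  rw [← antipode_mul_antidistrib, hv, antipode_one]

lemma antipode_surjective [FiniteDimensional k A] (Q : QuasiTriangular k A) :
    Function.Surjective S := by
  intro x
  obtain ⟨v, hv⟩ := Q.isUnit_drinfeld.exists_left_inv
  refine ⟨S (v * x * Q.drinfeld), Q.isUnit_drinfeld.mul_right_cancel ?_⟩
  obtain ⟨w, hw⟩ := Q.isUnit_drinfeld.exists_right_inv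
  rw [antipode_antipode_mul_drinfeld, ← mul_assoc, ← mul_assoc, left_inv_eq_right_inv hv hw, hw,
    one_mul]

/-- `u` and `S(u)` have the same trace in every finite-dimensional representation. -/
lemma trace_antipode_drinfeld {V : Type*} [AddCommGroup V] [Module k V]
    (ρ : A →ₐ[k] Module.End k V) :
    LinearMap.trace k V (ρ (S Q.drinfeld)) = LinearMap.trace k V (ρ Q.drinfeld) := by
  have h : ∀ t : A ⊗[k] A,
      LinearMap.trace k V (ρ (LinearMap.mul' k A (TensorProduct.map LinearMap.id S t))) =
        LinearMap.trace k V (ρ (drinfeldOf k A t)) := by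
    intro t
    induction t with
    | zero => simp [drinfeldOf_zero]
    | add x y hx hy => simp only [map_add, drinfeldOf_add, hx, hy]
    | tmul a b =>
      simp only [TensorProduct.map_tmul, LinearMap.mul'_apply, LinearMap.id_apply,
        drinfeldOf_tmul, map_mul]
      exact LinearMap.trace_mul_comm k _ _
  rw [antipode_drinfeld, h, drinfeld]

end Simple

/-- If `u` acts as a scalar in every simple module, so does `S(u)`. -/
lemma exists_antipode_drinfeld_smul {k : Type u} [Field k] {A : Type v} [Ring A]
    [HopfAlgebra k A] [FiniteDimensional k A] (Q : QuasiTriangular k A)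
    (hscalar : ∀ (V : Type v) [AddCommGroup V] [Module k V] [Module A V]
      [IsScalarTower k A V], IsSimpleModule A V → ∃ c : k, ∀ v : V, Q.drinfeld • v = c • v)
    (V : Type v) [AddCommGroup V] [Module k V] [Module A V] [IsScalarTower k A V]
    [FiniteDimensional k V] [IsSimpleModule A V] :
    ∃ c : k, ∀ v : V, HopfAlgebra.antipode k Q.drinfeld • v = c • v := by
  let S := HopfAlgebra.antipode k (A := A)
  let ρ := Algebra.lsmul k k V (A := A)
  let φ : A →+* Module.End k (Module.Dual k V) :=
    { toFun := fun a => (ρ (S a)).dualMap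
      map_one' := by ext; simp [S]
      map_mul' := fun a b => by ext; simp [S, HopfAlgebra.antipode_mul_antidistrib]
      map_zero' := by ext; simp
      map_add' := fun a b => by ext; simp }
  let : Module A (Module.Dual k V) := Module.compHom _ φ
  have hφ : ∀ (a : A) (f : Module.Dual k V) (v : V), (a • f) v = f (S a • v) :=
    fun a f v => rfl
  have : IsScalarTower k A (Module.Dual k V) :=
    ⟨fun c a f => LinearMap.ext fun v => by simp [hφ, S]⟩
  have : Nontrivial V := IsSimpleModule.nontrivial A V
  have : IsArtinian A (Module.Dual k V) := isArtinian_of_tower k inferInstance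
  obtain ⟨W, hW⟩ := IsAtomic.exists_atom (Submodule A (Module.Dual k V))
  have hWs : IsSimpleModule A W := isSimpleModule_iff_isAtom.mpr hW
  obtain ⟨L, hL, ⟨e⟩⟩ := isSimpleModule_iff_quot_maximal.mp hWs
  obtain ⟨c, hc⟩ := hscalar (A ⧸ L) ((LinearEquiv.isSimpleModule_iff e).mp hWs)
  have hcW : ∀ f ∈ W, Q.drinfeld • f = c • f := by
    intro f hf
    have h := hc (e ⟨f, hf⟩)
    rw [← algebraMap_smul A c, ← map_smul, ← map_smul] at h
    have := congr_arg Subtype.val (e.injective h)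
    simpa [algebraMap_smul] using this
  let N : Submodule A V :=
    { carrier := {v | ∀ f ∈ W, f v = 0}
      add_mem' := fun ha hb f hf => by rw [map_add, ha f hf, hb f hf, add_zero]
      zero_mem' := fun f _ => map_zero f
      smul_mem' := fun a v hv f hf => by
        obtain ⟨b, rfl⟩ := Q.antipode_surjective a
        exact hv _ (W.smul_mem b hf) }
  have hN : N = ⊥ := by
    refine (eq_bot_or_eq_top N).resolve_right fun hN => hW.1 ?_
    refine (Submodule.eq_bot_iff W).mpr fun f hf => LinearMap.ext fun v => ?_
    exact (hN ▸ Submodule.mem_top : v ∈ N) f hf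
  refine ⟨c, fun v => sub_eq_zero.mp ?_⟩
  rw [← Submodule.mem_bot A, ← hN]
  intro f hf
  have h : f (S Q.drinfeld • v) = c * f v := LinearMap.congr_fun (hcW f hf) v
  rw [map_sub, f.map_smul, smul_eq_mul, ← h, sub_self]

/-- If `u` acts as a scalar in every simple module, then `S(u) - u` lies in the radical. -/
lemma antipode_drinfeld_sub_mem_jacobson {k : Type u} [Field k] [CharZero k] {A : Type v} [Ring A]
    [HopfAlgebra k A] [FiniteDimensional k A] (Q : QuasiTriangular k A)
    (hscalar : ∀ (V : Type v) [AddCommGroup V] [Module k V] [Module A V]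
      [IsScalarTower k A V], IsSimpleModule A V → ∃ c : k, ∀ v : V, Q.drinfeld • v = c • v) :
    HopfAlgebra.antipode k Q.drinfeld - Q.drinfeld ∈ Ring.jacobson A := by
  rw [← Ideal.jacobson_bot, Ideal.jacobson, Submodule.mem_sInf]
  rintro L ⟨-, hL⟩
  have hs : IsSimpleModule A (A ⧸ L) := isSimpleModule_iff_isCoatom.mpr hL.out
  have : Nontrivial (A ⧸ L) := IsSimpleModule.nontrivial A _
  have : FiniteDimensional k (A ⧸ L) :=
    Module.Finite.of_surjective (L.mkQ.restrictScalars k) L.mkQ_surjective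
  obtain ⟨c, hc⟩ := hscalar (A ⧸ L) hs
  obtain ⟨d, hd⟩ := Q.exists_antipode_drinfeld_smul hscalar (A ⧸ L)
  have ht := Q.trace_antipode_drinfeld (Algebra.lsmul k k (A ⧸ L) (A := A))
  have hc' : Algebra.lsmul k k (A ⧸ L) Q.drinfeld = c • LinearMap.id := LinearMap.ext hc
  have hd' : Algebra.lsmul k k (A ⧸ L) (HopfAlgebra.antipode k Q.drinfeld) = d • LinearMap.id :=
    LinearMap.ext hd
  rw [hc', hd', map_smul, map_smul, LinearMap.trace_id] at ht
  have hcd : d = c := mul_right_cancel₀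
    (Nat.cast_ne_zero.mpr (Module.finrank_pos (R := k) (M := A ⧸ L)).ne') ht
  rw [← Submodule.Quotient.mk_eq_zero (p := L), Submodule.Quotient.mk_sub, sub_eq_zero]
  have h := (hd (Submodule.Quotient.mk 1)).trans (hcd ▸ (hc (Submodule.Quotient.mk 1)).symm)
  simpa [← Submodule.Quotient.mk_smul] using h

/-- `u S(u)⁻¹` is grouplike. -/
lemma isGroupLikeElem_of_drinfeld_eq_mul {k : Type*} [Field k] {A : Type*} [Ring A]
    [HopfAlgebra k A] [FiniteDimensional k A] (Q : QuasiTriangular k A) {g : A}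
    (hg : Q.drinfeld = g * HopfAlgebra.antipode k Q.drinfeld) : IsGroupLikeElem k g := by
  have hu := Q.isUnit_antipode_drinfeld
  set w := HopfAlgebra.antipode k Q.drinfeld with hw
  have hww : IsUnit (w ⊗ₜ[k] w) := by
    obtain ⟨v, hv⟩ := hu.exists_right_inv
    obtain ⟨v', hv'⟩ := hu.exists_left_inv
    exact ⟨⟨w ⊗ₜ w, v ⊗ₜ v, by simp [hv, Algebra.TensorProduct.one_def],
      by simp [← left_inv_eq_right_inv hv' hv, hv', Algebra.TensorProduct.one_def]⟩, rfl⟩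
  have hεu : IsUnit (Coalgebra.counit (R := k) w) := hu.map (Bialgebra.counitAlgHom k A)
  constructor
  · have h := congr_arg (Coalgebra.counit (R := k)) hg
    rw [Bialgebra.counit_mul, ← HopfAlgebra.counit_antipode, ← hw] at h
    exact hεu.mul_right_cancel (h.symm.trans (one_mul _).symm)
  · have h := Q.comul_drinfeld_mul
    have h' := Q.comul_antipode_drinfeld_mul
    rw [← hw] at h'
    rw [hg, Bialgebra.comul_mul, mul_assoc, h', ← Algebra.TensorProduct.tmul_mul_tmul] at h
    exact hww.mul_right_cancel h

end QuasiTriangular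

/-- Let `(A,R)` be a finite-dimensional quasitriangular Hopf algebra with
antipode `S` over a field `k` of characteristic `0`, and suppose the Drinfeld element `u`
of `A` acts as a scalar in every irreducible representation of `A`. Then `u = S(u)`, and
in particular `S⁴ = I`. -/
theorem antipode_drinfeld_eq_drinfeld
    (k : Type u) [Field k] [CharZero k]
    (A : Type v) [Ring A] [HopfAlgebra k A] [FiniteDimensional k A]
    (Q : QuasiTriangular k A)
    (hscalar : ∀ (V : Type v) [AddCommGroup V] [Module k V] [Module A V]
      [IsScalarTower k A V], IsSimpleModule A V → ∃ c : k, ∀ v : V, Q.drinfeld • v = c • v) :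
    HopfAlgebra.antipode (R := k) Q.drinfeld = Q.drinfeld ∧
    ∀ x : A,
      HopfAlgebra.antipode (R := k) (HopfAlgebra.antipode (R := k)
        (HopfAlgebra.antipode (R := k) (HopfAlgebra.antipode (R := k) x))) = x := by
  have hS : HopfAlgebra.antipode k Q.drinfeld = Q.drinfeld := by
    obtain ⟨v, hv⟩ := Q.isUnit_antipode_drinfeld.exists_left_inv
    have : IsArtinianRing A := IsArtinianRing.of_finite k A
    have hv' := mul_eq_one_comm.mp hv
    have hg : Q.drinfeld = Q.drinfeld * v * HopfAlgebra.antipode k Q.drinfeld := by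
      rw [mul_assoc, hv, mul_one]
    have hmem : Q.drinfeld * v - 1 ∈ Ring.jacobson A := by
      have h := (Ring.jacobson A).mul_mem_right v
        (neg_mem (Q.antipode_drinfeld_sub_mem_jacobson hscalar))
      rwa [neg_sub, sub_mul, hv'] at h
    have hnil : IsNilpotent (Q.drinfeld * v - 1) := by
      obtain ⟨n, hn⟩ := IsSemiprimaryRing.isNilpotent (R := A)
      exact ⟨n, by simpa [hn] using Ideal.pow_mem_pow hmem n⟩
    rw [eq_one_of_isGroupLikeElem (Q.isGroupLikeElem_of_drinfeld_eq_mul hg) hnil, one_mul] at hg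
    exact hg.symm
  refine ⟨hS, fun x => ?_⟩
  obtain ⟨y, rfl⟩ := Q.antipode_surjective x
  have h := congr_arg (HopfAlgebra.antipode k) (Q.antipode_antipode_mul_drinfeld y)
  rw [HopfAlgebra.antipode_mul_antidistrib, HopfAlgebra.antipode_mul_antidistrib, hS,
    ← Q.antipode_antipode_mul_drinfeld] at h
  exact Q.isUnit_drinfeld.mul_right_cancel h

end Paper
end
end

section
/- Let (A,R) be a minimal triangular pointed Hopf algebra over an algebraically closed field k of characteristic 0. Then every irreducible representation of A is 1-dimensional. -/
open TensorProduct

noncomputable section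

universe u v w

namespace Paper

variable (k : Type*) [Field k]

section Slices

/-- The slice map `a ⊗ b ↦ p(a) b`. -/
def leftSlice {k M : Type*} [Field k] [AddCommGroup M] [Module k M] (p : Module.Dual k M) :
    M ⊗[k] M →ₗ[k] M :=
  (TensorProduct.lid k M).toLinearMap ∘ₗ LinearMap.rTensor M p

/-- The slice map `a ⊗ b ↦ p(b) a`. -/
def rightSlice {k M : Type*} [Field k] [AddCommGroup M] [Module k M] (p : Module.Dual k M) :
    M ⊗[k] M →ₗ[k] M :=
  (TensorProduct.rid k M).toLinearMap ∘ₗ LinearMap.lTensor M p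

@[simp]
lemma leftSlice_tmul {k M : Type*} [Field k] [AddCommGroup M] [Module k M]
    (p : Module.Dual k M) (a b : M) : leftSlice p (a ⊗ₜ[k] b) = p a • b := by
  simp [leftSlice]

@[simp]
lemma rightSlice_tmul {k M : Type*} [Field k] [AddCommGroup M] [Module k M]
    (p : Module.Dual k M) (a b : M) : rightSlice p (a ⊗ₜ[k] b) = p b • a := by
  simp [rightSlice]

lemma exists_projection {k M : Type*} [Field k] [AddCommGroup M] [Module k M]
    (K : Submodule k M) : ∃ P : M →ₗ[k] M, (∀ x, P x ∈ K) ∧ ∀ x ∈ K, P x = x := by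
  obtain ⟨g, hg⟩ := K.subtype.exists_leftInverse_of_injective K.ker_subtype
  exact ⟨K.subtype ∘ₗ g, fun x => (g x).2,
    fun x hx => congrArg Subtype.val (LinearMap.congr_fun hg ⟨x, hx⟩)⟩

/-- If all left slices of `r` are fixed by `P`, then `(id ⊗ P)(r) = r`. -/
lemma lTensor_eq_self_of_leftSlice {k M : Type*} [Field k] [AddCommGroup M] [Module k M]
    {P : M →ₗ[k] M} {r : M ⊗[k] M} (h : ∀ p, P (leftSlice p r) = leftSlice p r) :
    LinearMap.lTensor M P r = r := by
  let B := Module.Basis.ofVectorSpace k M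
  obtain ⟨c, rfl⟩ := TensorProduct.eq_repr_basis_left B r
  have hc : ∀ i, leftSlice (B.coord i) (c.sum fun i n => B i ⊗ₜ[k] n) = c i := by
    intro i
    classical
    simp only [Finsupp.sum, map_sum, leftSlice_tmul, Module.Basis.coord_apply,
      Module.Basis.repr_self, Finsupp.single_apply, ite_smul, one_smul, zero_smul]
    simpa using Eq.symm
  simp only [Finsupp.sum, map_sum, LinearMap.lTensor_tmul]
  refine Finset.sum_congr rfl fun i _ => ?_
  have := h (B.coord i)
  rw [hc] at this
  rw [this]

/-- If all right slices of `r` are fixed by `P`, then `(P ⊗ id)(r) = r`. -/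
lemma rTensor_eq_self_of_rightSlice {k M : Type*} [Field k] [AddCommGroup M] [Module k M]
    {P : M →ₗ[k] M} {r : M ⊗[k] M} (h : ∀ p, P (rightSlice p r) = rightSlice p r) :
    LinearMap.rTensor M P r = r := by
  let B := Module.Basis.ofVectorSpace k M
  obtain ⟨c, rfl⟩ := TensorProduct.eq_repr_basis_right B r
  have hc : ∀ i, rightSlice (B.coord i) (c.sum fun i n => n ⊗ₜ[k] B i) = c i := by
    intro i
    classical
    simp only [Finsupp.sum, map_sum, rightSlice_tmul, Module.Basis.coord_apply,
      Module.Basis.repr_self, Finsupp.single_apply, ite_smul, one_smul, zero_smul]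
    simpa using Eq.symm
  simp only [Finsupp.sum, map_sum, LinearMap.rTensor_tmul]
  refine Finset.sum_congr rfl fun i _ => ?_
  have := h (B.coord i)
  rw [hc] at this
  rw [this]

lemma mem_range_map_subtype_of_slices {k M : Type*} [Field k] [AddCommGroup M] [Module k M]
    {K : Submodule k M} {r : M ⊗[k] M} (hl : ∀ p, leftSlice p r ∈ K)
    (hr : ∀ p, rightSlice p r ∈ K) :
    r ∈ LinearMap.range (TensorProduct.map K.subtype K.subtype) := by
  obtain ⟨P, hP, hP'⟩ := exists_projection K
  have h₁ := lTensor_eq_self_of_leftSlice fun p => hP' _ (hl p)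
  have h₂ := rTensor_eq_self_of_rightSlice fun p => hP' _ (hr p)
  have key : ∀ t : M ⊗[k] M, TensorProduct.map K.subtype K.subtype
      (TensorProduct.map (P.codRestrict K hP) (P.codRestrict K hP) t) =
        LinearMap.rTensor M P (LinearMap.lTensor M P t) := by
    intro t
    induction t using TensorProduct.induction_on with
    | zero => simp
    | tmul a b => rfl
    | add a b ha hb => simp only [map_add, ha, hb]
  exact ⟨_, by rw [key, h₁, h₂]⟩

lemma exists_finiteDimensional_leftSlice_mem {k M : Type*} [Field k] [AddCommGroup M]
    [Module k M] (r : M ⊗[k] M) :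
    ∃ F : Submodule k M, FiniteDimensional k F ∧ ∀ p, leftSlice p r ∈ F := by
  induction r using TensorProduct.induction_on with
  | zero => exact ⟨⊥, inferInstance, by simp⟩
  | tmul a b =>
    exact ⟨k ∙ b, inferInstance, fun p => by
      simpa using Submodule.smul_mem _ _ (Submodule.mem_span_singleton_self b)⟩
  | add x y hx hy =>
    obtain ⟨F, _, hF⟩ := hx
    obtain ⟨G, _, hG⟩ := hy
    exact ⟨F ⊔ G, inferInstance, fun p => by
      rw [map_add]
      exact add_mem (Submodule.mem_sup_left (hF p)) (Submodule.mem_sup_right (hG p))⟩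

/-- The submodule of all left slices of `r`. -/
def leftSliceSpan {k M : Type*} [Field k] [AddCommGroup M] [Module k M] (r : M ⊗[k] M) :
    Submodule k M where
  carrier := Set.range fun p => leftSlice p r
  zero_mem' := ⟨0, by simp [leftSlice]⟩
  add_mem' := by
    rintro _ _ ⟨p, rfl⟩ ⟨q, rfl⟩
    exact ⟨p + q, by simp [leftSlice, LinearMap.rTensor_add]⟩
  smul_mem' := by
    rintro c _ ⟨p, rfl⟩
    exact ⟨c • p, by simp [leftSlice, LinearMap.rTensor_smul]⟩

lemma leftSlice_comm {k M : Type*} [Field k] [AddCommGroup M] [Module k M]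
    (p : Module.Dual k M) (r : M ⊗[k] M) :
    leftSlice p (TensorProduct.comm k M M r) = rightSlice p r := by
  induction r using TensorProduct.induction_on with
  | zero => simp
  | tmul a b => simp
  | add x y hx hy => simp only [map_add, hx, hy]

lemma rightSlice_comm {k M : Type*} [Field k] [AddCommGroup M] [Module k M]
    (p : Module.Dual k M) (r : M ⊗[k] M) :
    rightSlice p (TensorProduct.comm k M M r) = leftSlice p r := by
  rw [← leftSlice_comm, TensorProduct.comm_comm]

lemma leftSlice_rTensor {k M : Type*} [Field k] [AddCommGroup M] [Module k M]
    (p : Module.Dual k M) (f : M →ₗ[k] M) (r : M ⊗[k] M) :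
    leftSlice p (LinearMap.rTensor M f r) = leftSlice (p ∘ₗ f) r := by
  induction r using TensorProduct.induction_on with
  | zero => simp
  | tmul a b => simp
  | add x y hx hy => simp only [map_add, hx, hy]

lemma rightSlice_rTensor {k M : Type*} [Field k] [AddCommGroup M] [Module k M]
    (p : Module.Dual k M) (f : M →ₗ[k] M) (r : M ⊗[k] M) :
    rightSlice p (LinearMap.rTensor M f r) = f (rightSlice p r) := by
  induction r using TensorProduct.induction_on with
  | zero => simp
  | tmul a b => simp
  | add x y hx hy => simp only [map_add, hx, hy]

end Slices

section Convolution

/-- The convolution product of two functionals on a coalgebra. -/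
def convMul {k M : Type*} [Field k] [AddCommGroup M] [Module k M] (d : M →ₗ[k] M ⊗[k] M)
    (p q : Module.Dual k M) : Module.Dual k M :=
  LinearMap.mul' k k ∘ₗ TensorProduct.map p q ∘ₗ d

lemma convMul_apply_eq_leftSlice {k M : Type*} [Field k] [AddCommGroup M] [Module k M]
    (d : M →ₗ[k] M ⊗[k] M) (p q : Module.Dual k M) (x : M) :
    convMul d p q x = q (leftSlice p (d x)) := by
  rw [convMul, LinearMap.comp_apply, LinearMap.comp_apply]
  induction d x using TensorProduct.induction_on with
  | zero => simp
  | tmul a b => simp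
  | add x y hx hy => simp only [map_add, hx, hy]

lemma convMul_apply_eq_rightSlice {k M : Type*} [Field k] [AddCommGroup M] [Module k M]
    (d : M →ₗ[k] M ⊗[k] M) (p q : Module.Dual k M) (x : M) :
    convMul d p q x = p (rightSlice q (d x)) := by
  rw [convMul, LinearMap.comp_apply, LinearMap.comp_apply]
  induction d x using TensorProduct.induction_on with
  | zero => simp
  | tmul a b => simp [mul_comm]
  | add x y hx hy => simp only [map_add, hx, hy]

lemma leftSlice_mem_of_mem_range {k M : Type*} [Field k] [AddCommGroup M] [Module k M]
    {D : Submodule k M} {t : M ⊗[k] M}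
    (ht : t ∈ LinearMap.range (TensorProduct.map D.subtype D.subtype)) (p : Module.Dual k M) :
    leftSlice p t ∈ D := by
  obtain ⟨s, rfl⟩ := ht
  induction s using TensorProduct.induction_on with
  | zero => simp
  | tmul a b => simpa using D.smul_mem _ b.2
  | add x y hx hy => simpa only [map_add] using add_mem hx hy

lemma rightSlice_mem_of_mem_range {k M : Type*} [Field k] [AddCommGroup M] [Module k M]
    {D : Submodule k M} {t : M ⊗[k] M}
    (ht : t ∈ LinearMap.range (TensorProduct.map D.subtype D.subtype)) (p : Module.Dual k M) :
    rightSlice p t ∈ D := by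
  obtain ⟨s, rfl⟩ := ht
  induction s using TensorProduct.induction_on with
  | zero => simp
  | tmul a b => simpa using D.smul_mem _ a.2
  | add x y hx hy => simpa only [map_add] using add_mem hx hy

/-- A simple quotient of the convolution algebra of a finite-dimensional pointed coalgebra is
`1`-dimensional. -/
theorem finrank_eq_one_of_isPointedOf_s7 {k M S : Type*} [Field k] [AddCommGroup M] [Module k M]
    [FiniteDimensional k M] [Ring S] [Algebra k S] [IsSimpleRing S]
    {d : M →ₗ[k] M ⊗[k] M} (hd : IsPointedOf k d) (T : Module.Dual k M →ₗ[k] S)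
    (hT : Function.Surjective T) (hmul : ∀ p q, T (convMul d p q) = T p * T q) :
    Module.finrank k S = 1 := by
  set I : Submodule k (Module.Dual k M) := LinearMap.ker T with hI
  set C : Submodule k M := I.dualCoannihilator with hC
  have hCI : C.dualAnnihilator = I := Subspace.dualCoannihilator_dualAnnihilator_eq
  have hrank : Module.finrank k C = Module.finrank k S := by
    have h₁ : _ + Module.finrank k C = _ := Subspace.finrank_add_finrank_dualCoannihilator_eq I
    have h₂ := LinearMap.finrank_range_add_finrank_ker T
    rw [LinearMap.range_eq_top.mpr hT, finrank_top, Subspace.dual_finrank_eq, ← hI] at h₂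
    omega
  rw [← hrank]
  refine hd C ⟨?_, ?_, ?_⟩
  · intro hbot
    rw [hbot, Submodule.dualAnnihilator_bot] at hCI
    obtain ⟨p, hp⟩ := hT 1
    have : p ∈ I := hCI ▸ Submodule.mem_top
    rw [hI, LinearMap.mem_ker, hp] at this
    exact one_ne_zero this
  · intro x hx
    rw [hC, Submodule.mem_dualCoannihilator] at hx
    refine mem_range_map_subtype_of_slices (fun p => ?_) (fun p => ?_)
    · rw [hC, Submodule.mem_dualCoannihilator]
      intro q hq
      rw [← convMul_apply_eq_leftSlice]
      refine hx _ ?_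
      rw [hI, LinearMap.mem_ker] at hq ⊢
      rw [hmul, hq, mul_zero]
    · rw [hC, Submodule.mem_dualCoannihilator]
      intro q hq
      rw [← convMul_apply_eq_rightSlice]
      refine hx _ ?_
      rw [hI, LinearMap.mem_ker] at hq ⊢
      rw [hmul, hq, zero_mul]
  · intro D hD hDC
    have hID : I ≤ D.dualAnnihilator := hCI ▸ Submodule.dualAnnihilator_anti hDC
    have hleft : ∀ p, ∀ q ∈ D.dualAnnihilator, convMul d p q ∈ D.dualAnnihilator := by
      intro p q hq
      rw [Submodule.mem_dualAnnihilator] at hq ⊢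
      intro x hx
      rw [convMul_apply_eq_leftSlice]
      exact hq _ (leftSlice_mem_of_mem_range (hD x hx) p)
    have hright : ∀ p, ∀ q ∈ D.dualAnnihilator, convMul d q p ∈ D.dualAnnihilator := by
      intro p q hq
      rw [Submodule.mem_dualAnnihilator] at hq ⊢
      intro x hx
      rw [convMul_apply_eq_rightSlice]
      exact hq _ (rightSlice_mem_of_mem_range (hD x hx) p)
    let J : Ideal S :=
      { (D.dualAnnihilator.map T).toAddSubmonoid with
        smul_mem' := by
          rintro s _ ⟨q, hq, rfl⟩
          obtain ⟨p, rfl⟩ := hT s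
          exact ⟨convMul d p q, hleft p q hq, hmul p q⟩ }
    have hJ : J.IsTwoSided := ⟨by
      rintro _ s ⟨q, hq, rfl⟩
      obtain ⟨p, rfl⟩ := hT s
      exact ⟨convMul d q p, hright p q hq, hmul q p⟩⟩
    rw [← Subspace.dualAnnihilator_dualCoannihilator_eq (W := D)]
    rcases (isSimpleRing_iff_isTwoSided_imp.mp ‹IsSimpleRing S›).2 J hJ with h | h
    · right
      have : D.dualAnnihilator = I := by
        refine le_antisymm (fun q hq => ?_) hID
        have : T q ∈ J := ⟨q, hq, rfl⟩
        rwa [h] at this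
      rw [this]
    · left
      have : D.dualAnnihilator = ⊤ := by
        refine eq_top_iff.mpr fun q _ => ?_
        obtain ⟨q', hq', hqq⟩ : T q ∈ J := h ▸ Submodule.mem_top
        rw [← sub_add_cancel q q']
        refine add_mem (hID ?_) hq'
        rw [hI, LinearMap.mem_ker, map_sub, hqq, sub_self]
      rw [this, Submodule.dualCoannihilator_top]

end Convolution

section RMatrix

variable {k A : Type*} [Field k] [Ring A] [HopfAlgebra k A]

lemma leftSlice_convMul {r : A ⊗[k] A} (h : Hexagon₁ k A r) (p q : Module.Dual k A) :
    leftSlice (convMul Coalgebra.comul p q) r = leftSlice p r * leftSlice q r := by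
  let Φ : (A ⊗[k] A) ⊗[k] A →ₗ[k] A :=
    (TensorProduct.lid k A).toLinearMap ∘ₗ
      LinearMap.rTensor A (LinearMap.mul' k k ∘ₗ TensorProduct.map p q)
  have h₁ : ∀ t : A ⊗[k] A,
      Φ (Algebra.TensorProduct.map (Bialgebra.comulAlgHom k A) (AlgHom.id k A) t) =
        leftSlice (convMul Coalgebra.comul p q) t := by
    intro t
    induction t using TensorProduct.induction_on with
    | zero => simp
    | tmul a b => simp [Φ, convMul]
    | add x y hx hy => simp only [map_add, hx, hy]
  have h₂ : ∀ t s : A ⊗[k] A,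
      Φ (Algebra.TensorProduct.map (Algebra.TensorProduct.includeLeft (R := k) (S := k))
          (AlgHom.id k A) t *
        Algebra.TensorProduct.map (Algebra.TensorProduct.includeRight (R := k))
          (AlgHom.id k A) s) = leftSlice p t * leftSlice q s := by
    intro t s
    induction t using TensorProduct.induction_on with
    | zero => simp
    | add x y hx hy => simp only [map_add, add_mul, hx, hy]
    | tmul a b =>
      induction s using TensorProduct.induction_on with
      | zero => simp
      | add x y hx hy => simp only [map_add, mul_add, hx, hy]
      | tmul a' b' => simp [Φ, smul_smul, mul_comm]
  rw [← h₁, h, h₂]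

lemma comul_leftSlice (p : Module.Dual k A) (r : A ⊗[k] A) :
    Coalgebra.comul (R := k) (leftSlice p r) =
      TensorProduct.lid k (A ⊗[k] A) (LinearMap.rTensor (A ⊗[k] A) p
        (Algebra.TensorProduct.map (AlgHom.id k A) (Bialgebra.comulAlgHom k A) r)) := by
  induction r using TensorProduct.induction_on with
  | zero => simp
  | tmul a b => simp
  | add x y hx hy => simp only [map_add, hx, hy]

lemma comul_leftSlice_mem {r : A ⊗[k] A} (h : Hexagon₂ k A r) {K : Submodule k A}
    (hK : ∀ p, leftSlice p r ∈ K) (p : Module.Dual k A) :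
    Coalgebra.comul (R := k) (leftSlice p r) ∈
      LinearMap.range (TensorProduct.map K.subtype K.subtype) := by
  obtain ⟨P, hP, hP'⟩ := exists_projection K
  have hr : LinearMap.lTensor A P r = r :=
    lTensor_eq_self_of_leftSlice fun p => hP' _ (hK p)
  rw [comul_leftSlice, h, ← hr]
  suffices ∀ t s : A ⊗[k] A, TensorProduct.lid k (A ⊗[k] A) (LinearMap.rTensor (A ⊗[k] A) p
      (Algebra.TensorProduct.map (AlgHom.id k A) (Algebra.TensorProduct.includeRight (R := k))
          (LinearMap.lTensor A P t) *
        Algebra.TensorProduct.map (AlgHom.id k A)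
          (Algebra.TensorProduct.includeLeft (R := k) (S := k)) (LinearMap.lTensor A P s))) ∈
      LinearMap.range (TensorProduct.map K.subtype K.subtype) from this r r
  intro t s
  induction t using TensorProduct.induction_on with
  | zero => simp
  | add x y hx hy => simpa only [map_add, add_mul] using add_mem hx hy
  | tmul a b =>
    induction s using TensorProduct.induction_on with
    | zero => simp
    | add x y hx hy => simpa only [map_add, mul_add] using add_mem hx hy
    | tmul a' b' =>
      refine ⟨p (a * a') • ((⟨P b', hP b'⟩ : K) ⊗ₜ[k] (⟨P b, hP b⟩ : K)), ?_⟩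
      simp

lemma leftSlice_counit {r : A ⊗[k] A} (h : Hexagon₁ k A r) (hr : IsUnit r) :
    leftSlice Coalgebra.counit r = 1 := by
  let e : A ⊗[k] A →ₐ[k] A := (Algebra.TensorProduct.lid k A).toAlgHom.comp
    (Algebra.TensorProduct.map (Bialgebra.counitAlgHom k A) (AlgHom.id k A))
  have he : ∀ t, e t = leftSlice Coalgebra.counit t := by
    intro t
    induction t using TensorProduct.induction_on with
    | zero => simp
    | tmul a b => simp [e]
    | add x y hx hy => simp only [map_add, hx, hy]
  have hu : IsUnit (leftSlice (Coalgebra.counit (R := k)) r) := he r ▸ hr.map e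
  have hc : convMul Coalgebra.comul (Coalgebra.counit (R := k) (A := A)) Coalgebra.counit =
      Coalgebra.counit := by
    ext x
    rw [convMul_apply_eq_leftSlice, leftSlice, LinearMap.comp_apply,
      Coalgebra.rTensor_counit_comul]
    simp
  have := leftSlice_convMul h Coalgebra.counit Coalgebra.counit
  rw [hc] at this
  exact hu.mul_left_cancel (by rw [← this, mul_one])

lemma rTensor_antipode_mul_self {r : A ⊗[k] A} (h : Hexagon₁ k A r) (hr : IsUnit r) :
    LinearMap.rTensor A (HopfAlgebra.antipode k) r * r = 1 := by
  let Ψ : (A ⊗[k] A) ⊗[k] A →ₗ[k] A ⊗[k] A :=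
    LinearMap.rTensor A (LinearMap.mul' k A ∘ₗ LinearMap.rTensor A (HopfAlgebra.antipode k))
  have h₁ : ∀ t : A ⊗[k] A,
      Ψ (Algebra.TensorProduct.map (Bialgebra.comulAlgHom k A) (AlgHom.id k A) t) =
        1 ⊗ₜ leftSlice Coalgebra.counit t := by
    intro t
    induction t using TensorProduct.induction_on with
    | zero => simp
    | tmul a b =>
      simp [Ψ, HopfAlgebra.mul_antipode_rTensor_comul_apply, Algebra.algebraMap_eq_smul_one,
        TensorProduct.smul_tmul]
    | add x y hx hy => simp only [map_add, hx, hy, TensorProduct.tmul_add]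
  have h₂ : ∀ t s : A ⊗[k] A,
      Ψ (Algebra.TensorProduct.map (Algebra.TensorProduct.includeLeft (R := k) (S := k))
          (AlgHom.id k A) t *
        Algebra.TensorProduct.map (Algebra.TensorProduct.includeRight (R := k))
          (AlgHom.id k A) s) = LinearMap.rTensor A (HopfAlgebra.antipode k) t * s := by
    intro t s
    induction t using TensorProduct.induction_on with
    | zero => simp
    | add x y hx hy => simp only [map_add, add_mul, hx, hy]
    | tmul a b =>
      induction s using TensorProduct.induction_on with
      | zero => simp
      | add x y hx hy => simp only [map_add, mul_add, hx, hy]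
      | tmul a' b' => simp [Ψ]
  rw [← h₂, ← h, h₁, leftSlice_counit h hr, Algebra.TensorProduct.one_def]

lemma rTensor_antipode_eq_comm {Q : QuasiTriangular k A} (htri : Q.IsTriangular) :
    LinearMap.rTensor A (HopfAlgebra.antipode k) Q.R = TensorProduct.comm k A A Q.R :=
  left_inv_eq_right_inv (rTensor_antipode_mul_self Q.hexagon₁ Q.isUnit) htri

/-- In a minimal triangular Hopf algebra, every element is a left slice of the R-matrix. -/
theorem leftSliceSpan_eq_top {Q : QuasiTriangular k A} (htri : Q.IsTriangular)
    (hmin : Q.IsMinimal) : leftSliceSpan Q.R = ⊤ := by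
  have hS := rTensor_antipode_eq_comm htri
  have hrl : ∀ p, rightSlice p Q.R = leftSlice (p ∘ₗ HopfAlgebra.antipode k) Q.R := fun p => by
    rw [← leftSlice_rTensor, hS, leftSlice_comm]
  have hlr : ∀ p, leftSlice p Q.R = HopfAlgebra.antipode k (rightSlice p Q.R) := fun p => by
    rw [← rightSlice_rTensor, hS, rightSlice_comm]
  set K := leftSliceSpan Q.R with hK
  have hl : ∀ p, leftSlice p Q.R ∈ K := fun p => ⟨p, rfl⟩
  have : FiniteDimensional k K := by
    obtain ⟨F, _, hF⟩ := exists_finiteDimensional_leftSlice_mem Q.R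
    exact Submodule.finiteDimensional_of_le (show K ≤ F by rintro _ ⟨p, rfl⟩; exact hF p)
  let L : Submodule k A := leftSliceSpan (TensorProduct.comm k A A Q.R)
  have hLK : L ≤ K := by
    rintro _ ⟨p, rfl⟩
    exact ⟨p ∘ₗ HopfAlgebra.antipode k, by simp only [leftSlice_comm, hrl]⟩
  have hKL : K = L.map (HopfAlgebra.antipode k) := by
    apply le_antisymm
    · rintro _ ⟨p, rfl⟩
      exact ⟨_, ⟨p, rfl⟩, by simp only [leftSlice_comm, hlr]⟩
    · rintro _ ⟨_, ⟨p, rfl⟩, rfl⟩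
      exact ⟨p, by simp only [leftSlice_comm, hlr]⟩
  have : FiniteDimensional k L := Submodule.finiteDimensional_of_le hLK
  have hLK' : L = K := Submodule.eq_of_le_of_finrank_le hLK <| by
    conv_lhs => rw [hKL]
    exact Submodule.finrank_map_le _ _
  let B : Subalgebra k A := K.toSubalgebra
    ⟨Coalgebra.counit, leftSlice_counit Q.hexagon₁ Q.isUnit⟩ <| by
      rintro _ _ ⟨p, rfl⟩ ⟨q, rfl⟩
      exact ⟨_, leftSlice_convMul Q.hexagon₁ p q⟩
  have hB : B.toSubmodule = K := Submodule.toSubalgebra_toSubmodule ..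
  have hBtop : B = ⊤ := by
    refine hmin B ⟨?_, ?_⟩ ?_
    · rintro _ ⟨p, rfl⟩
      exact comul_leftSlice_mem Q.hexagon₂ hl p
    · intro x hx
      change HopfAlgebra.antipode k x ∈ K
      rw [hKL]
      exact ⟨x, hLK' ▸ hx, rfl⟩
    · exact mem_range_map_subtype_of_slices hl fun p => hrl p ▸ hl _
  rw [← hB, hBtop, Algebra.top_toSubmodule]

end RMatrix

/-- Burnside's theorem: a finite-dimensional algebra over an algebraically closed field acts on
a simple module through all linear endomorphisms. -/
theorem lsmul_surjective_of_isSimpleModule {k A V : Type*} [Field k] [IsAlgClosed k] [Ring A]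
    [Algebra k A] [AddCommGroup V] [Module k V] [Module A V] [IsScalarTower k A V]
    [IsSimpleModule A V] [FiniteDimensional k V] :
    Function.Surjective (Algebra.lsmul k k V : A →ₐ[k] Module.End k V) := by
  intro f
  have hsc := (IsSimpleModule.algebraMap_end_bijective_of_isAlgClosed (A := A) (V := V) k).2
  let f' : Module.End (Module.End A V) V :=
    { f with
      map_smul' := by
        intro g v
        obtain ⟨c, rfl⟩ := hsc g
        exact f.map_smul c v }
  have ⟨s, hs⟩ := Module.Finite.fg_top (R := k) (M := V)
  obtain ⟨a, ha⟩ := jacobson_density f' s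
  refine ⟨a, LinearMap.ext_on (s := s) hs fun v hv => (ha v hv).symm⟩

instance isSimpleRing_end {k V : Type*} [Field k] [AddCommGroup V] [Module k V]
    [FiniteDimensional k V] [Nontrivial V] : IsSimpleRing (Module.End k V) := by
  let b := Module.finBasis k V
  have : Nonempty (Fin (Module.finrank k V)) := ⟨⟨0, Module.finrank_pos⟩⟩
  exact .of_ringEquiv (algEquivMatrix b).symm.toRingEquiv inferInstance

/-- Let `(A,R)` be a minimal triangular pointed Hopf algebra over an
algebraically closed field `k` of characteristic `0`. Then every irreducible
representation of `A` is `1`-dimensional. -/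
theorem irreducible_representations_one_dimensional
    (k : Type u) [Field k] [IsAlgClosed k] [CharZero k]
    (A : Type v) [Ring A] [HopfAlgebra k A]
    (Q : QuasiTriangular k A) (htri : Q.IsTriangular) (hmin : Q.IsMinimal)
    (hpointed : IsPointed k A) :
    ∀ (V : Type v) [AddCommGroup V] [Module k V] [Module A V] [IsScalarTower k A V],
      IsSimpleModule A V → Module.finrank k V = 1 := by
  intro V _ _ _ _ _
  have htop := leftSliceSpan_eq_top htri hmin
  have : FiniteDimensional k A := by
    obtain ⟨F, _, hF⟩ := exists_finiteDimensional_leftSlice_mem Q.R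
    have hle : leftSliceSpan Q.R ≤ F := by rintro _ ⟨p, rfl⟩; exact hF p
    rw [htop, top_le_iff] at hle
    exact Module.finite_def.mpr (hle ▸ (Submodule.fg_iff_finiteDimensional F).mpr ‹_›)
  have : FiniteDimensional k V := Module.Finite.trans A V
  have : Nontrivial V := IsSimpleModule.nontrivial A V
  let f : Module.Dual k A →ₗ[k] A :=
    { toFun := fun p => leftSlice p Q.R
      map_add' := fun p q => by simp [leftSlice, LinearMap.rTensor_add]
      map_smul' := fun c p => by simp [leftSlice, LinearMap.rTensor_smul] }
  have hf : Function.Surjective f := fun a => by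
    have : a ∈ leftSliceSpan Q.R := htop ▸ Submodule.mem_top
    exact this
  have h := finrank_eq_one_of_isPointedOf_s7 hpointed
    ((Algebra.lsmul k k V : A →ₐ[k] Module.End k V).toLinearMap ∘ₗ f)
    (lsmul_surjective_of_isSimpleModule.comp hf)
    fun p q => by
      change Algebra.lsmul k k V (leftSlice _ Q.R) = _
      rw [leftSlice_convMul Q.hexagon₁, map_mul]
      rfl
  rw [Module.finrank_linearMap] at h
  exact Nat.eq_one_of_mul_eq_one_left h

end Paper
end
end
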